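/- Assume the Irrationality Hypothesis. Then the almost sure theory T^α is a consistent complete theory: T^α has a model, and for every L⁺-sentence φ, exactly one of φ and ¬φ belongs to T^α. -/

import Mathlib

open FirstOrder Filter Topology
open scoped Classical

/-- The finite relational language with relation symbols `R i` of arity `k i`, for `i : Fin p`. -/
def Lang (p : ℕ) (k : Fin p → ℕ) : FirstOrder.Language where
  Functions := fun _ => Empty
  Relations := fun n => { i : Fin p // k i = n }

variable {p : ℕ}

section StructureDefs

/-- The relation `R i` holds on the finite set `C` (set-version of the relation). -/
def HoldsOn (k : Fin p → ℕ) {M : Type*} [(Lang p k).Structure M]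
    (i : Fin p) (C : Finset M) : Prop :=
  ∃ v : Fin (k i) → M, Function.Injective v ∧ Finset.image v Finset.univ = C ∧
    Language.Structure.RelMap (L := Lang p k) (⟨i, rfl⟩ : (Lang p k).Relations (k i)) v

/-- `w i A` : the number of `k i`-element subsets of `A` on which `R i` holds. -/
noncomputable def w (k : Fin p → ℕ) {M : Type*} [(Lang p k).Structure M]
    (i : Fin p) (A : Finset M) : ℕ :=
  Set.ncard {C : Finset M | C ⊆ A ∧ C.card = k i ∧ HoldsOn k i C}

/-- `e(A) = Σ_i α_i · w_i(A)`. -/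
noncomputable def eVal (k : Fin p → ℕ) (α : Fin p → ℝ) {M : Type*} [(Lang p k).Structure M]
    (A : Finset M) : ℝ :=
  ∑ i : Fin p, α i * (w k i A : ℝ)

/-- `δ(A) = |A| − e(A)`. -/
noncomputable def delta (k : Fin p → ℕ) (α : Fin p → ℝ) {M : Type*} [(Lang p k).Structure M]
    (A : Finset M) : ℝ :=
  (A.card : ℝ) - eVal k α A

/-- A structure is symmetric and irreflexive: relations hold only on tuples of pairwise
distinct elements and are invariant under permutations of the tuple. -/
def SymmIrr (k : Fin p → ℕ) (M : Type*) [(Lang p k).Structure M] : Prop :=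
  (∀ (n : ℕ) (r : (Lang p k).Relations n) (v : Fin n → M),
      Language.Structure.RelMap r v → Function.Injective v) ∧
  (∀ (n : ℕ) (r : (Lang p k).Relations n) (v : Fin n → M) (σ : Equiv.Perm (Fin n)),
      Language.Structure.RelMap r v → Language.Structure.RelMap r (v ∘ σ))

/-- Membership in the class `K`: a symmetric irreflexive structure all of whose finite
substructures have (hereditarily) nonnegative `δ`. -/
def InK (k : Fin p → ℕ) (α : Fin p → ℝ) (M : Type*) [(Lang p k).Structure M] : Prop :=
  SymmIrr k M ∧ ∀ A : Finset M, 0 ≤ delta k α A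

/-- A finite structure is in `K_α` if it is symmetric irreflexive and `δ(A) ≥ 0` for every
substructure. -/
def InKalpha (k : Fin p → ℕ) (α : Fin p → ℝ) (B : Type*) [(Lang p k).Structure B] : Prop :=
  SymmIrr k B ∧ ∀ S : Finset B, 0 ≤ delta k α S

/-- `d_B(X) = inf { δ(Y) : X ⊆ Y ⊆ B }` (relative version, inside the finite set `B`). -/
noncomputable def dRel (k : Fin p → ℕ) (α : Fin p → ℝ) {M : Type*} [(Lang p k).Structure M]
    (B X : Finset M) : ℝ :=
  sInf {r : ℝ | ∃ Y : Finset M, X ⊆ Y ∧ Y ⊆ B ∧ r = delta k α Y}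

/-- `A ≤_s B` for finite sets: `A ⊆ B` and `d_A(X) = d_B(X)` for all `X ⊆ A`. -/
def StrongIn (k : Fin p → ℕ) (α : Fin p → ℝ) {M : Type*} [(Lang p k).Structure M]
    (A B : Finset M) : Prop :=
  A ⊆ B ∧ ∀ X : Finset M, X ⊆ A → dRel k α A X = dRel k α B X

/-- `A ≤_i B` (intrinsic extension): there is no `A'` with `A ⊆ A' ⊊ B` and `A' ≤_s B`. -/
def IntrinsicIn (k : Fin p → ℕ) (α : Fin p → ℝ) {M : Type*} [(Lang p k).Structure M]
    (A B : Finset M) : Prop :=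
  A ⊆ B ∧ ∀ A' : Finset M, A ⊆ A' → A' ⊂ B → ¬ StrongIn k α A' B

/-- `cl^m_M(A)`: the union of all `B ⊆ M` with `A ≤_i B` and `|B − A| < m`. -/
def cl (k : Fin p → ℕ) (α : Fin p → ℝ) {M : Type*} [(Lang p k).Structure M]
    (m : ℕ) (A : Finset M) : Set M :=
  {x : M | ∃ B : Finset M, IntrinsicIn k α A B ∧ (B \ A).card < m ∧ x ∈ B}

/-- `C` and `B'` are freely joined over `A` (inside the ambient structure): they intersect in
`A` and every relation on a subset of `C ∪ B'` lives entirely inside `C` or inside `B'`. -/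
def FreelyJoined (k : Fin p → ℕ) {M : Type*} [(Lang p k).Structure M]
    (A C B' : Set M) : Prop :=
  C ∩ B' = A ∧
    ∀ (i : Fin p) (S : Finset M), ↑S ⊆ C ∪ B' → HoldsOn k i S → (↑S ⊆ C ∨ ↑S ⊆ B')

/-- `g` is an embedding (of relational structures). -/
def IsEmb (k : Fin p → ℕ) {M N : Type*} [(Lang p k).Structure M] [(Lang p k).Structure N]
    (g : M → N) : Prop :=
  Function.Injective g ∧
    ∀ (n : ℕ) (r : (Lang p k).Relations n) (v : Fin n → M),
      (Language.Structure.RelMap r (g ∘ v) ↔ Language.Structure.RelMap r v)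

/-- `g` restricted to `A` is an embedding of the substructure on `A`. -/
def IsEmbOn (k : Fin p → ℕ) {M N : Type*} [(Lang p k).Structure M] [(Lang p k).Structure N]
    (A : Finset M) (g : M → N) : Prop :=
  Set.InjOn g ↑A ∧
    ∀ (n : ℕ) (r : (Lang p k).Relations n) (v : Fin n → M), (∀ j, v j ∈ A) →
      (Language.Structure.RelMap r (g ∘ v) ↔ Language.Structure.RelMap r v)

/-- `h` restricts to an isomorphism from the induced structure on `S` onto `S'`. -/
def IsIsoOn (k : Fin p → ℕ) {M N : Type*} [(Lang p k).Structure M] [(Lang p k).Structure N]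
    (S : Set M) (S' : Set N) (h : M → N) : Prop :=
  Set.InjOn h S ∧ h '' S = S' ∧
    ∀ (n : ℕ) (r : (Lang p k).Relations n) (v : Fin n → M), (∀ j, v j ∈ S) →
      (Language.Structure.RelMap r (h ∘ v) ↔ Language.Structure.RelMap r v)

/-- A countable structure `M ∈ K` is `(K_α, ≤_s)`-semigeneric if for every `A ≤_s B` with
`B ∈ K_α` finite and every embedding `g` of `A` into `M`, and each `m`, there is an embedding
`ĝ` of `B` into `M` extending `g` whose image adds nothing to the `m`-closure of `gA` and is
freely joined with `cl^m(gA)` over `gA`. -/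
def Semigeneric (k : Fin p → ℕ) (α : Fin p → ℝ) (M : Type*) [(Lang p k).Structure M] : Prop :=
  Countable M ∧ InK k α M ∧
    ∀ (B : Type) (_ : Fintype B) (_ : (Lang p k).Structure B), InKalpha k α B →
      ∀ A : Finset B, StrongIn k α A Finset.univ →
        ∀ g : B → M, IsEmbOn k A g → ∀ m : ℕ,
          ∃ g' : B → M, IsEmb k g' ∧ (∀ a ∈ A, g' a = g a) ∧
            cl k α m (Finset.image g' Finset.univ) =
              ↑(Finset.image g' Finset.univ) ∪ cl k α m (Finset.image g A) ∧
            FreelyJoined k (↑(Finset.image g A) : Set M) (cl k α m (Finset.image g A))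
              (↑(Finset.image g' Finset.univ))

end StructureDefs

section FormulaDefs

/-- A formula is existential if it is an existential quantifier prefix applied to a
quantifier-free formula. -/
def IsExistential (k : Fin p → ℕ) {r : ℕ} (φ : (Lang p k).Formula (Fin r)) : Prop :=
  ∃ (m : ℕ) (ψ : (Lang p k).BoundedFormula (Fin r) m), ψ.IsQF ∧ φ = ψ.exs

/-- Boolean combinations of existential formulas. -/
inductive IsBoolCombExistential (k : Fin p → ℕ) {r : ℕ} :
    (Lang p k).Formula (Fin r) → Prop
  | of_existential (φ) : IsExistential k φ → IsBoolCombExistential k φ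
  | not (φ) : IsBoolCombExistential k φ → IsBoolCombExistential k φ.not
  | inf (φ ψ) : IsBoolCombExistential k φ → IsBoolCombExistential k ψ →
      IsBoolCombExistential k (φ ⊓ ψ)

end FormulaDefs

section Probability

/-- A configuration of potential relations on `{1,…,n}`: for each relation symbol, a Boolean
choice on each finite subset. -/
abbrev Config (p n : ℕ) := (i : Fin p) → Finset (Fin n) → Bool

/-- The valid configurations: `R i` may only hold on sets of size `k i`. -/
noncomputable def validE (k : Fin p → ℕ) (n : ℕ) : Finset (Config p n) :=
  Finset.univ.filter (fun E => ∀ (i : Fin p) (C : Finset (Fin n)), E i C = true → C.card = k i)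

/-- The probability of the configuration `E`: independently for each `i` and each
`k i`-element set `C`, the relation `R i` holds on `C` with probability `γ i · n^{-α i}`. -/
noncomputable def weight (k : Fin p → ℕ) (α γ : Fin p → ℝ) (n : ℕ) (E : Config p n) : ℝ :=
  ∏ i : Fin p, ∏ C ∈ Finset.univ.filter (fun C : Finset (Fin n) => C.card = k i),
    (if E i C = true then γ i * (n : ℝ) ^ (-(α i)) else 1 - γ i * (n : ℝ) ^ (-(α i)))

/-- The probability `P_n` of an event (a set of configurations). -/
noncomputable def Pev (k : Fin p → ℕ) (α γ : Fin p → ℝ) (n : ℕ)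
    (Q : Config p n → Prop) : ℝ :=
  ∑ E ∈ validE k n, if Q E then weight k α γ n E else 0

/-- The random `L⁺`-structure `G_n` on `Fin n` determined by the configuration `E`. -/
def structOf (k : Fin p → ℕ) (n : ℕ) (E : Config p n) : (Lang p k).Structure (Fin n) where
  funMap := fun {_} f _ => f.elim
  RelMap := fun {_} r v => Function.Injective v ∧ E r.1 (Finset.image v Finset.univ) = true

/-- The probability that `G_n ⊨ φ`. -/
noncomputable def Pn (k : Fin p → ℕ) (α γ : Fin p → ℝ) (n : ℕ)
    (φ : (Lang p k).Sentence) : ℝ :=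
  Pev k α γ n (fun E => letI := structOf k n E; (Fin n) ⊨ φ)

/-- The Irrationality Hypothesis: `α_0, …, α_{p−1}, 1` are linearly independent over `ℚ`. -/
def IrrHyp (α : Fin p → ℝ) : Prop :=
  LinearIndependent ℚ (Fin.snoc α (1 : ℝ) : Fin (p + 1) → ℝ)

/-- The almost sure theory `T^α`: the sentences with limit probability 1. -/
noncomputable def Talpha (k : Fin p → ℕ) (α γ : Fin p → ℝ) : (Lang p k).Theory :=
  {φ : (Lang p k).Sentence | Tendsto (fun n => Pn k α γ n φ) atTop (𝓝 1)}

/-- Auxiliary: `M`, equipped with the structure `S`, satisfies the sentence `φ`. -/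
def RealizeS (k : Fin p → ℕ) (M : Type*) (S : (Lang p k).Structure M)
    (φ : (Lang p k).Sentence) : Prop :=
  letI := S; M ⊨ φ

/-- Auxiliary: `M`, equipped with the structure `S`, is a model of the theory `T`. -/
def ModelsT (k : Fin p → ℕ) (M : Type*) (S : (Lang p k).Structure M)
    (T : (Lang p k).Theory) : Prop :=
  ∀ φ ∈ T, RealizeS k M S φ

end Probability

theorem exists_pos_forall_le {β : Type*} (s : Finset β) (f : β → ℝ) (h : ∀ x ∈ s, 0 < f x) :
    ∃ ε : ℝ, 0 < ε ∧ ∀ x ∈ s, ε ≤ f x := by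
  rcases s.eq_empty_or_nonempty with rfl | hs
  · exact ⟨1, one_pos, by simp⟩
  · obtain ⟨y, hy, hmin⟩ := s.exists_min_image f hs
    exact ⟨f y, h y hy, hmin⟩

section Predimension

/-- The values `l - ∑ αᵢ mᵢ` with `l` bounded do not accumulate at `d` from below. -/
theorem exists_gap {α : Fin p → ℝ} (hα : ∀ i, 0 < α i) (d : ℝ) (t : ℕ) :
    ∃ ε : ℝ, 0 < ε ∧ ∀ (l : ℕ) (m : Fin p → ℕ), l ≤ t →
      (l : ℝ) - ∑ i, α i * (m i : ℝ) < d → (l : ℝ) - ∑ i, α i * (m i : ℝ) ≤ d - ε := by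
  let B : Fin p → ℕ := fun i => ⌈(t + 1 - d) / α i⌉₊
  let s : Finset (ℕ × (Fin p → ℕ)) :=
    (Finset.Iic t ×ˢ Finset.Iic B).filter (fun x => (x.1 : ℝ) - ∑ i, α i * (x.2 i : ℝ) < d)
  obtain ⟨ε, hε, h⟩ := exists_pos_forall_le s
    (fun x => d - ((x.1 : ℝ) - ∑ i, α i * (x.2 i : ℝ))) (fun x hx => by
      have := (Finset.mem_filter.1 hx).2
      linarith)
  refine ⟨min ε 1, lt_min hε one_pos, fun l m hl hd => ?_⟩
  by_cases hv : d - 1 ≤ (l : ℝ) - ∑ i, α i * (m i : ℝ)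
  · have hm : (l, m) ∈ s := by
      refine Finset.mem_filter.2 ⟨Finset.mem_product.2 ⟨Finset.mem_Iic.2 hl,
        Finset.mem_Iic.2 fun i => ?_⟩, hd⟩
      have h1 : α i * (m i : ℝ) ≤ ∑ i, α i * (m i : ℝ) :=
        Finset.single_le_sum (f := fun i => α i * (m i : ℝ))
          (fun j _ => mul_nonneg (hα j).le (Nat.cast_nonneg _)) (Finset.mem_univ i)
      have h2 : (l : ℝ) ≤ t := by exact_mod_cast hl
      have h3 : (m i : ℝ) ≤ (t + 1 - d) / α i := by
        rw [le_div_iff₀ (hα i)]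
        linarith
      exact Nat.cast_le.1 (h3.trans (Nat.le_ceil _))
    have := h _ hm
    have h4 := min_le_left ε 1
    simp only at this
    linarith
  · have h4 := min_le_right ε 1
    linarith

/-- The total `α`-weight of a finite set of labelled edges. -/
noncomputable def edgeWeight (α : Fin p → ℝ) {V : Type*} (T : Finset (Fin p × Finset V)) : ℝ :=
  ∑ e ∈ T, α e.1

/-- The edges contained in a vertex set. -/
def edgesIn {V : Type*} [DecidableEq V] (F : Finset (Fin p × Finset V)) (X : Finset V) :
    Finset (Fin p × Finset V) :=
  F.filter (fun e => e.2 ⊆ X)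

/-- The predimension `|X| - e(X)` in the labelled hypergraph `F`. -/
noncomputable def predim (α : Fin p → ℝ) {V : Type*} [DecidableEq V]
    (F : Finset (Fin p × Finset V)) (X : Finset V) : ℝ :=
  (X.card : ℝ) - edgeWeight α (edgesIn F X)

/-- `X` has no extension of smaller predimension by at most `t` new vertices. -/
def ClosedUpTo (α : Fin p → ℝ) {V : Type*} [DecidableEq V]
    (F : Finset (Fin p × Finset V)) (t : ℕ) (X : Finset V) : Prop :=
  ∀ Z : Finset V, X ⊆ Z → (Z \ X).card ≤ t → predim α F X ≤ predim α F Z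

variable {V : Type*}

theorem edgeWeight_eq (α : Fin p → ℝ) (T : Finset (Fin p × Finset V)) :
    edgeWeight α T = ∑ i, α i * ((T.filter (fun e => e.1 = i)).card : ℝ) := by
  unfold edgeWeight
  rw [← Finset.sum_fiberwise (s := T) (g := fun e => e.1)]
  refine Finset.sum_congr rfl fun i _ => ?_
  rw [Finset.sum_congr rfl (g := fun _ => α i)]
  · simp [mul_comm]
  · intro e he
    rw [(Finset.mem_filter.1 he).2]

theorem edgeWeight_mono {α : Fin p → ℝ} (hα : ∀ i, 0 < α i) {S T : Finset (Fin p × Finset V)}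
    (h : S ⊆ T) : edgeWeight α S ≤ edgeWeight α T :=
  Finset.sum_le_sum_of_subset_of_nonneg h fun e _ _ => (hα e.1).le

theorem edgeWeight_nonneg {α : Fin p → ℝ} (hα : ∀ i, 0 < α i) (T : Finset (Fin p × Finset V)) :
    0 ≤ edgeWeight α T :=
  Finset.sum_nonneg fun e _ => (hα e.1).le

variable [DecidableEq V]

theorem mem_edgesIn {F : Finset (Fin p × Finset V)} {X : Finset V} {e : Fin p × Finset V} :
    e ∈ edgesIn F X ↔ e ∈ F ∧ e.2 ⊆ X :=
  Finset.mem_filter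

theorem edgesIn_mono (F : Finset (Fin p × Finset V)) {X Y : Finset V} (h : X ⊆ Y) :
    edgesIn F X ⊆ edgesIn F Y := fun _ he =>
  mem_edgesIn.2 ⟨(mem_edgesIn.1 he).1, (mem_edgesIn.1 he).2.trans h⟩

theorem predim_sub (α : Fin p → ℝ) (F : Finset (Fin p × Finset V)) {X Z : Finset V} (h : X ⊆ Z) :
    predim α F Z - predim α F X =
      ((Z \ X).card : ℝ) - edgeWeight α (edgesIn F Z \ edgesIn F X) := by
  have h1 := Finset.card_sdiff_add_card_eq_card h
  have h2 := Finset.sum_sdiff (f := fun e : Fin p × Finset V => α e.1) (edgesIn_mono F h)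
  unfold predim edgeWeight
  rw [← h1, ← h2]
  push_cast
  ring

theorem predim_le_card {α : Fin p → ℝ} (hα : ∀ i, 0 < α i) (F : Finset (Fin p × Finset V))
    (X : Finset V) : predim α F X ≤ X.card := by
  have := edgeWeight_nonneg hα (edgesIn F X)
  unfold predim
  linarith

theorem predim_submodular {α : Fin p → ℝ} (hα : ∀ i, 0 < α i) (F : Finset (Fin p × Finset V))
    (X Y : Finset V) :
    predim α F (X ∪ Y) + predim α F (X ∩ Y) ≤ predim α F X + predim α F Y := by
  have h1 : ((X ∪ Y).card : ℝ) + (X ∩ Y).card = X.card + Y.card := by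
    exact_mod_cast Finset.card_union_add_card_inter X Y
  have h2 := Finset.sum_union_inter (f := fun e : Fin p × Finset V => α e.1)
    (s₁ := edgesIn F X) (s₂ := edgesIn F Y)
  have h3 : edgesIn F X ∩ edgesIn F Y = edgesIn F (X ∩ Y) := by
    ext e
    simp only [Finset.mem_inter, mem_edgesIn, Finset.subset_inter_iff]
    tauto
  have h4 : edgesIn F X ∪ edgesIn F Y ⊆ edgesIn F (X ∪ Y) :=
    Finset.union_subset (edgesIn_mono F Finset.subset_union_left)
      (edgesIn_mono F Finset.subset_union_right)
  have h5 := edgeWeight_mono hα h4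
  unfold predim
  unfold edgeWeight at *
  rw [h3] at h2
  linarith

theorem exists_predim_gap {α : Fin p → ℝ} (hα : ∀ i, 0 < α i) (d : ℝ) (t : ℕ) :
    ∃ ε : ℝ, 0 < ε ∧ ∀ {V : Type} [DecidableEq V] (F : Finset (Fin p × Finset V))
      {X Z : Finset V}, X ⊆ Z → (Z \ X).card ≤ t → predim α F Z < predim α F X + d →
        predim α F Z ≤ predim α F X + d - ε := by
  obtain ⟨ε, hε, h⟩ := exists_gap hα d t
  refine ⟨ε, hε, fun F X Z hXZ hc hlt => ?_⟩
  have h1 := predim_sub α F hXZ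
  rw [edgeWeight_eq] at h1
  have := h _ _ hc (by rw [← h1]; linarith)
  rw [← h1] at this
  linarith

theorem predim_ne_of_ssubset {α : Fin p → ℝ} (hirr : IrrHyp α) (F : Finset (Fin p × Finset V))
    {X Z : Finset V} (h : X ⊂ Z) : predim α F Z ≠ predim α F X := by
  intro heq
  have h1 := predim_sub α F h.1
  rw [edgeWeight_eq, heq, sub_self] at h1
  set m : Fin p → ℕ := fun i =>
    ((edgesIn F Z \ edgesIn F X).filter (fun e => e.1 = i)).card with hm
  have h2 := Fintype.linearIndependent_iff.1 hirr
    (Fin.snoc (fun i => -(m i : ℚ)) ((Z \ X).card : ℚ)) (by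
      rw [Fin.sum_univ_castSucc]
      simp only [Fin.snoc_castSucc, Fin.snoc_last, Rat.smul_def]
      push_cast
      simp only [neg_mul, Finset.sum_neg_distrib, mul_one]
      simp only [hm]
      rw [h1]
      simp only [mul_comm]
      ring) (Fin.last p)
  simp only [Fin.snoc_last, Nat.cast_eq_zero, Finset.card_eq_zero,
    Finset.sdiff_eq_empty_iff_subset] at h2
  exact h.2 h2

theorem ClosedUpTo.mono {α : Fin p → ℝ} {F : Finset (Fin p × Finset V)} {s t : ℕ} {X : Finset V}
    (h : ClosedUpTo α F t X) (hst : s ≤ t) : ClosedUpTo α F s X :=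
  fun Z hZ hc => h Z hZ (hc.trans hst)

theorem exists_closedUpTo_aux {α : Fin p → ℝ} {t : ℕ} {ε : ℝ} {F : Finset (Fin p × Finset V)}
    (hgap : ∀ {X Z : Finset V}, X ⊆ Z → (Z \ X).card ≤ t → predim α F Z < predim α F X →
      predim α F Z ≤ predim α F X - ε) {N : ℕ} (hN : ∀ X : Finset V, X.card ≤ N → 0 ≤ predim α F X)
    (K : ℕ) : ∀ X : Finset V, predim α F X < K * ε → X.card + K * t ≤ N →
      ∃ Y : Finset V, X ⊆ Y ∧ Y.card ≤ X.card + K * t ∧ ClosedUpTo α F t Y := by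
  induction K with
  | zero =>
    intro X h1 h2
    have := hN X (by omega)
    simp at h1
    linarith
  | succ K ih =>
    intro X h1 h2
    by_cases hc : ClosedUpTo α F t X
    · exact ⟨X, subset_rfl, by omega, hc⟩
    · unfold ClosedUpTo at hc
      push Not at hc
      obtain ⟨Z, hXZ, hZ, hlt⟩ := hc
      have h3 := hgap hXZ hZ hlt
      have h4 := Finset.card_sdiff_add_card_eq_card hXZ
      have h5 : (K + 1) * t = K * t + t := by ring
      push_cast at h1
      obtain ⟨Y, hY1, hY2, hY3⟩ := ih Z (by linarith) (by omega)
      exact ⟨Y, hXZ.trans hY1, by omega, hY3⟩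

/-- Small sets have closed supersets of bounded size, provided that all sets of bounded size
have nonnegative predimension. -/
theorem exists_closedUpTo {α : Fin p → ℝ} (hα : ∀ i, 0 < α i) (s t : ℕ) :
    ∃ N : ℕ, ∀ {V : Type} [DecidableEq V] (F : Finset (Fin p × Finset V)),
      (∀ X : Finset V, X.card ≤ N → 0 ≤ predim α F X) → ∀ X : Finset V, X.card ≤ s →
        ∃ Y : Finset V, X ⊆ Y ∧ Y.card ≤ N ∧ ClosedUpTo α F t Y := by
  obtain ⟨ε, hε, hgap⟩ := exists_predim_gap hα 0 t
  obtain ⟨K, hK⟩ := exists_nat_gt ((s : ℝ) / ε)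
  refine ⟨s + K * t, fun F hN X hX => ?_⟩
  rw [div_lt_iff₀ hε] at hK
  obtain ⟨Y, h1, h2, h3⟩ := exists_closedUpTo_aux (α := α) (F := F) (ε := ε) (t := t)
    (fun h1 h2 h3 => by simpa using hgap F h1 h2 (by simpa using h3)) hN K X
    (((predim_le_card hα F X).trans (by exact_mod_cast hX)).trans_lt hK) (by omega)
  exact ⟨Y, h1, by omega, h3⟩

/-- `x` preserves and reflects the edges on subsets of `A`. -/
def PreservesEdges {W : Type*} (E : Finset (Fin p × Finset W)) (F : Finset (Fin p × Finset V))
    (A : Finset W) (x : W → V) : Prop :=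
  ∀ e : Fin p × Finset W, e.2 ⊆ A → (e ∈ E ↔ (e.1, e.2.image x) ∈ F)

theorem PreservesEdges.mono {W : Type*} {E : Finset (Fin p × Finset W)}
    {F : Finset (Fin p × Finset V)} {A B : Finset W} {x : W → V} (h : PreservesEdges E F A x)
    (hB : B ⊆ A) : PreservesEdges E F B x :=
  fun e he => h e (he.trans hB)

theorem image_eq_image_of_injOn {W : Type*} [DecidableEq W] {A : Finset W} {x : W → V}
    (hx : Set.InjOn x A) {S T : Finset W} (hS : S ⊆ A) (hT : T ⊆ A) (h : S.image x = T.image x) :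
    S = T := by
  ext u
  constructor
  · intro hu
    obtain ⟨v, hv, hvu⟩ := Finset.mem_image.1 (h ▸ Finset.mem_image_of_mem x hu)
    rwa [← hx (hT hv) (hS hu) hvu]
  · intro hu
    obtain ⟨v, hv, hvu⟩ := Finset.mem_image.1 (h ▸ Finset.mem_image_of_mem x hu)
    rwa [← hx (hS hv) (hT hu) hvu]

theorem injOn_edge_image {W : Type*} [DecidableEq W] {A : Finset W} {x : W → V}
    (hx : Set.InjOn x A) (T : Finset (Fin p × Finset W)) (hT : ∀ e ∈ T, e.2 ⊆ A) :
    Set.InjOn (fun e : Fin p × Finset W => (e.1, e.2.image x)) T := by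
  intro e he f hf h
  simp only [Prod.mk.injEq] at h
  exact Prod.ext h.1 (image_eq_image_of_injOn hx (hT e he) (hT f hf) h.2)

theorem predim_image {W : Type*} [DecidableEq W] (α : Fin p → ℝ) {E : Finset (Fin p × Finset W)}
    {F : Finset (Fin p × Finset V)} {A : Finset W} {x : W → V} (h : PreservesEdges E F A x)
    (hx : Set.InjOn x A) : predim α F (A.image x) = predim α E A := by
  have h1 : edgesIn F (A.image x) = (edgesIn E A).image (fun e => (e.1, e.2.image x)) := by
    ext ⟨i, C⟩
    simp only [mem_edgesIn, Finset.mem_image, Prod.mk.injEq]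
    constructor
    · rintro ⟨h1, h2⟩
      obtain ⟨D, hD, rfl⟩ := Finset.subset_image_iff.1 h2
      have hD : D ⊆ A := by exact_mod_cast hD
      exact ⟨(i, D), ⟨(h (i, D) hD).2 h1, hD⟩, rfl, rfl⟩
    · rintro ⟨⟨j, D⟩, ⟨h1, h2⟩, rfl, rfl⟩
      exact ⟨(h (j, D) h2).1 h1, Finset.image_subset_image h2⟩
  unfold predim edgeWeight
  rw [h1, Finset.card_image_of_injOn hx, Finset.sum_image
    (injOn_edge_image hx _ fun e he => (mem_edgesIn.1 he).2)]

end Predimension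

section BackAndForth

theorem closedUpTo_of_subset {V : Type*} [DecidableEq V] {α : Fin p → ℝ} (hα : ∀ i, 0 < α i)
    {F : Finset (Fin p × Finset V)} {t : ℕ} {X Y : Finset V} (hXY : X ⊆ Y)
    (hY : ClosedUpTo α F t Y)
    (hX : ∀ Z : Finset V, X ⊆ Z → Z ⊆ Y → (Z \ X).card ≤ t → predim α F X ≤ predim α F Z) :
    ClosedUpTo α F t X := by
  intro Z hXZ hc
  have h1 := predim_submodular hα F Z Y
  have h2 := hX (Z ∩ Y) (Finset.subset_inter hXZ hXY) Finset.inter_subset_right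
    ((Finset.card_le_card (Finset.sdiff_subset_sdiff Finset.inter_subset_left subset_rfl)).trans
      hc)
  have h3 := hY (Z ∪ Y) Finset.subset_union_right ((Finset.card_le_card (by
    intro v hv
    simp only [Finset.mem_sdiff, Finset.mem_union] at hv ⊢
    exact ⟨hv.1.resolve_right hv.2, fun h => hv.2 (hXY h)⟩)).trans hc)
  linarith

/-- Every edge has the arity prescribed by its label. -/
def ArityValid (k : Fin p → ℕ) {V : Type*} (F : Finset (Fin p × Finset V)) : Prop :=
  ∀ e ∈ F, e.2.card = k e.1

/-- Every sufficiently closed copy of `A` in `F` extends to a copy of `E` closed up to `t`. -/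
def ExtensionProperty (α : Fin p → ℝ) {b n : ℕ} (E : Finset (Fin p × Finset (Fin b)))
    (A : Finset (Fin b)) (t : ℕ) (F : Finset (Fin p × Finset (Fin n))) : Prop :=
  ∀ x : Fin b → Fin n, Set.InjOn x A → PreservesEdges E F A x →
    ClosedUpTo α F ((Finset.univ \ A).card + t) (A.image x) →
      ∃ y : Fin b → Fin n, Function.Injective y ∧ (∀ u ∈ A, y u = x u) ∧
        PreservesEdges E F Finset.univ y ∧ ClosedUpTo α F t (Finset.univ.image y)

/-- `A` has minimal predimension among its supersets. -/
def Safe (α : Fin p → ℝ) {b : ℕ} (E : Finset (Fin p × Finset (Fin b))) (A : Finset (Fin b)) :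
    Prop :=
  ∀ S : Finset (Fin b), A ⊆ S → predim α E A ≤ predim α E S

/-- The almost sure properties of the random hypergraph up to level `Q`. -/
structure Typical (k : Fin p → ℕ) (α : Fin p → ℝ) (Q : ℕ) {n : ℕ}
    (F : Finset (Fin p × Finset (Fin n))) : Prop where
  pos : 0 < n
  arity : ArityValid k F
  nonneg : ∀ X : Finset (Fin n), X.card ≤ Q → 0 ≤ predim α F X
  extension : ∀ b t : ℕ, b ≤ Q → t ≤ Q → ∀ (E : Finset (Fin p × Finset (Fin b)))
    (A : Finset (Fin b)), ArityValid k E → Safe α E A → ExtensionProperty α E A t F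

theorem Typical.mono {k : Fin p → ℕ} {α : Fin p → ℝ} {Q R n : ℕ}
    {F : Finset (Fin p × Finset (Fin n))} (h : Typical k α Q F) (hR : R ≤ Q) : Typical k α R F :=
  ⟨h.pos, h.arity, fun X hX => h.nonneg X (hX.trans hR),
    fun b t hb ht => h.extension b t (hb.trans hR) (ht.trans hR)⟩

/-- Two closed copies of the same finite structure inside `F` and `F'`. -/
structure CommonPart (α : Fin p → ℝ) (s t : ℕ) {V V' : Type} [DecidableEq V] [DecidableEq V']
    (F : Finset (Fin p × Finset V)) (F' : Finset (Fin p × Finset V'))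
    {ι : Type} [Fintype ι] (x : ι → V) (y : ι → V') : Prop where
  inj_left : Function.Injective x
  inj_right : Function.Injective y
  edges : ∀ e : Fin p × Finset ι, (e.1, e.2.image x) ∈ F ↔ (e.1, e.2.image y) ∈ F'
  card_le : Fintype.card ι ≤ s
  closed_left : ClosedUpTo α F t (Finset.univ.image x)
  closed_right : ClosedUpTo α F' t (Finset.univ.image y)

theorem CommonPart.symm {α : Fin p → ℝ} {s t : ℕ} {V V' : Type} [DecidableEq V] [DecidableEq V']
    {F : Finset (Fin p × Finset V)} {F' : Finset (Fin p × Finset V')} {ι : Type} [Fintype ι]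
    {x : ι → V} {y : ι → V'} (h : CommonPart α s t F F' x y) : CommonPart α s t F' F y x :=
  ⟨h.inj_right, h.inj_left, fun e => (h.edges e).symm, h.card_le, h.closed_right, h.closed_left⟩

theorem CommonPart.mono {α : Fin p → ℝ} {s t t' : ℕ} {V V' : Type} [DecidableEq V]
    [DecidableEq V']
    {F : Finset (Fin p × Finset V)} {F' : Finset (Fin p × Finset V')} {ι : Type} [Fintype ι]
    {x : ι → V} {y : ι → V'} (h : CommonPart α s t F F' x y) (ht : t' ≤ t) :
    CommonPart α s t' F F' x y :=
  ⟨h.inj_left, h.inj_right, h.edges, h.card_le, h.closed_left.mono ht, h.closed_right.mono ht⟩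

/-- Transport of an extension of a common part to the other side. -/
theorem CommonPart.exists_extension {k : Fin p → ℕ} {α : Fin p → ℝ} {s t t' N Q : ℕ} {n m : ℕ}
    {F : Finset (Fin p × Finset (Fin n))} {F' : Finset (Fin p × Finset (Fin m))}
    {ι : Type} [Fintype ι] {x : ι → Fin n} {y : ι → Fin m} (h : CommonPart α s t F F' x y)
    (hF : ArityValid k F) (hF' : Typical k α Q F') (hQ : s + N ≤ Q) (ht' : t' ≤ Q)
    (ht : N + t' ≤ t) (H : Finset (Fin n)) (hH : H.card ≤ N) :
    ∃ (b : ℕ) (u : Fin b → Fin n) (v : Fin b → Fin m), Function.Injective u ∧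
      Function.Injective v ∧ (∀ e : Fin p × Finset (Fin b),
        (e.1, e.2.image u) ∈ F ↔ (e.1, e.2.image v) ∈ F') ∧
      H ⊆ Finset.univ.image u ∧ (∀ i w, u w = x i → v w = y i) ∧
      ClosedUpTo α F' t' (Finset.univ.image v) := by
  set X : Finset (Fin n) := Finset.univ.image x with hX
  set b := (X ∪ H).card with hb
  let u : Fin b → Fin n := (X ∪ H).orderEmbOfFin rfl
  have hu : Function.Injective u := ((X ∪ H).orderEmbOfFin rfl).injective
  have hur : Finset.univ.image u = X ∪ H := by
    rw [← Finset.coe_inj, Finset.coe_image, Finset.coe_univ, Set.image_univ]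
    exact (X ∪ H).range_orderEmbOfFin rfl
  let E : Finset (Fin p × Finset (Fin b)) :=
    Finset.univ.filter (fun e => (e.1, e.2.image u) ∈ F)
  have hE : ∀ e, e ∈ E ↔ (e.1, e.2.image u) ∈ F := fun e => by simp [E]
  let A : Finset (Fin b) := Finset.univ.filter (fun w => u w ∈ X)
  have hA : ∀ w, w ∈ A ↔ u w ∈ X := fun w => by simp [A]
  have hAX : A.image u = X := by
    ext w
    simp only [Finset.mem_image, hA]
    constructor
    · rintro ⟨a, ha, rfl⟩
      exact ha
    · intro hw
      obtain ⟨a, -, rfl⟩ := Finset.mem_image.1 (hur ▸ Finset.mem_union_left H hw)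
      exact ⟨a, hw, rfl⟩
  have hXc : X.card ≤ s := (Finset.card_image_le.trans_eq (by simp)).trans h.card_le
  have hEF : ∀ S, PreservesEdges E F S u := fun S e _ => hE e
  have hUA : ((Finset.univ : Finset (Fin b)) \ A).card ≤ N := by
    rw [← Finset.card_image_of_injective _ hu]
    refine (Finset.card_le_card ?_).trans hH
    intro w hw
    obtain ⟨a, ha, rfl⟩ := Finset.mem_image.1 hw
    have h1 : u a ∈ X ∪ H := hur ▸ Finset.mem_image_of_mem u (Finset.mem_univ a)
    have h2 : u a ∉ X := fun h3 => (Finset.mem_sdiff.1 ha).2 ((hA a).2 h3)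
    exact (Finset.mem_union.1 h1).resolve_left h2
  have hsafe : Safe α E A := by
    intro S hS
    rw [← predim_image α (hEF A) hu.injOn, ← predim_image α (hEF S) hu.injOn, hAX]
    refine h.closed_left _ (by rw [← hX, ← hAX]; exact Finset.image_subset_image hS) ?_
    rw [← hX, ← hAX, ← Finset.image_sdiff _ _ hu]
    refine Finset.card_image_le.trans ((Finset.card_le_card ?_).trans (hUA.trans (by omega)))
    exact Finset.sdiff_subset_sdiff (Finset.subset_univ S) subset_rfl
  have hval : ArityValid k E := fun e he => by
    rw [← hF _ ((hE e).1 he), Finset.card_image_of_injective _ hu]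
  have hx0 : ∃ x0 : Fin b → Fin m, ∀ w i, x i = u w → x0 w = y i := by
    have : ∀ w, ∃ d : Fin m, ∀ i, x i = u w → d = y i := by
      intro w
      by_cases hw : ∃ i, x i = u w
      · obtain ⟨i, hi⟩ := hw
        exact ⟨y i, fun i' hi' => congrArg y (h.inj_left (hi.trans hi'.symm))⟩
      · exact ⟨⟨0, hF'.pos⟩, fun i hi => absurd ⟨i, hi⟩ hw⟩
    choose x0 hx0 using this
    exact ⟨x0, hx0⟩
  obtain ⟨x0, hx0⟩ := hx0
  have hAx : ∀ w ∈ A, ∃ i, x i = u w := fun w hw => by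
    simpa [X] using (hA w).1 hw
  have hxA : ∀ i, ∃ w ∈ A, x i = u w := fun i => by
    have h1 : x i ∈ X := Finset.mem_image_of_mem x (Finset.mem_univ i)
    rw [← hAX] at h1
    obtain ⟨w, hw, h2⟩ := Finset.mem_image.1 h1
    exact ⟨w, hw, h2.symm⟩
  have hinj : Set.InjOn x0 A := by
    intro w hw w' hw' heq
    obtain ⟨i, hi⟩ := hAx w hw
    obtain ⟨i', hi'⟩ := hAx w' hw'
    rw [hx0 w i hi, hx0 w' i' hi'] at heq
    exact hu (by rw [← hi, ← hi', h.inj_right heq])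
  have hpres : PreservesEdges E F' A x0 := by
    intro e he
    let T : Finset ι := Finset.univ.filter (fun i => x i ∈ e.2.image u)
    have h1 : T.image x = e.2.image u := by
      ext w
      simp only [Finset.mem_image, T, Finset.mem_filter, Finset.mem_univ, true_and]
      constructor
      · rintro ⟨i, hi, rfl⟩
        exact hi
      · rintro ⟨a, ha, rfl⟩
        obtain ⟨i, hi⟩ := hAx a (he ha)
        exact ⟨i, ⟨a, ha, hi.symm⟩, hi⟩
    have h2 : T.image y = e.2.image x0 := by
      ext w
      simp only [Finset.mem_image, T, Finset.mem_filter, Finset.mem_univ, true_and]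
      constructor
      · rintro ⟨i, ⟨a, ha, hi⟩, rfl⟩
        exact ⟨a, ha, hx0 a i hi.symm⟩
      · rintro ⟨a, ha, rfl⟩
        obtain ⟨i, hi⟩ := hAx a (he ha)
        exact ⟨i, ⟨a, ha, hi.symm⟩, (hx0 a i hi).symm⟩
    rw [hE, ← h1, ← h2]
    exact h.edges (e.1, T)
  have hAy : A.image x0 = Finset.univ.image y := by
    ext w
    simp only [Finset.mem_image, Finset.mem_univ, true_and]
    constructor
    · rintro ⟨a, ha, rfl⟩
      obtain ⟨i, hi⟩ := hAx a ha
      exact ⟨i, (hx0 a i hi).symm⟩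
    · rintro ⟨i, rfl⟩
      obtain ⟨a, ha, hi⟩ := hxA i
      exact ⟨a, ha, hx0 a i hi⟩
  obtain ⟨v, hv, hvx, hvE, hvc⟩ := hF'.extension b t' (by
      rw [hb]
      exact (Finset.card_union_le _ _).trans (by omega)) ht' E A hval hsafe x0 hinj hpres
    (hAy ▸ h.closed_right.mono (by omega))
  refine ⟨b, u, v, hu, hv, fun e => ?_, hur ▸ Finset.subset_union_right, fun i w hw => ?_, hvc⟩
  · rw [← hE]
    exact hvE e (Finset.subset_univ _)
  · rw [hvx w ((hA w).2 (hw ▸ Finset.mem_image_of_mem x (Finset.mem_univ i))), hx0 w i hw.symm]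

/-- The forth step of the back-and-forth argument. -/
theorem CommonPart.forth {k : Fin p → ℕ} {α : Fin p → ℝ} (hα : ∀ i, 0 < α i) {r t' N : ℕ}
    (hN : ∀ {V : Type} [DecidableEq V] (F : Finset (Fin p × Finset V)),
      (∀ X : Finset V, X.card ≤ N → 0 ≤ predim α F X) → ∀ X : Finset V, X.card ≤ r + 1 →
        ∃ Y : Finset V, X ⊆ Y ∧ Y.card ≤ N ∧ ClosedUpTo α F t' Y)
    {s t Q n m : ℕ} {F : Finset (Fin p × Finset (Fin n))} {F' : Finset (Fin p × Finset (Fin m))}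
    {ι : Type} [Fintype ι] {x : ι → Fin n} {y : ι → Fin m} (h : CommonPart α s t F F' x y)
    (hF : Typical k α Q F) (hF' : Typical k α Q F') (hQ : s + N ≤ Q) (ht' : t' ≤ Q)
    (ht : N + t' ≤ t) (j : Fin r → ι) (c : Fin n) :
    ∃ (ι' : Type) (_ : Fintype ι') (x' : ι' → Fin n) (y' : ι' → Fin m) (j' : Fin (r + 1) → ι')
      (d : Fin m), CommonPart α N t' F F' x' y' ∧
        x' ∘ j' = Fin.snoc (x ∘ j) c ∧ y' ∘ j' = Fin.snoc (y ∘ j) d := by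
  let a : Fin (r + 1) → Fin n := Fin.snoc (x ∘ j) c
  obtain ⟨H, haH, hHc, hH⟩ := hN F (fun X hX => hF.nonneg X (by omega)) (Finset.univ.image a)
    (Finset.card_image_le.trans (by simp))
  obtain ⟨b, u, v, hu, hv, huv, hHu, hxy, hvc⟩ :=
    h.exists_extension hF.arity hF' hQ ht' ht H hHc
  have hHim : ∀ w ∈ H, ∃ z, u z = w := fun w hw => by simpa using hHu hw
  let ι' := {z : Fin b // u z ∈ H}
  have hux : Finset.univ.image (fun z : ι' => u z) = H := by
    ext w
    simp only [Finset.mem_image, Finset.mem_univ, true_and]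
    constructor
    · rintro ⟨z, rfl⟩
      exact z.2
    · intro hw
      obtain ⟨z, rfl⟩ := hHim w hw
      exact ⟨⟨z, hw⟩, rfl⟩
  have hinj : Function.Injective (fun z : ι' => u z) := fun z z' hz => Subtype.ext (hu hz)
  let H0 : Finset (Fin b) := Finset.univ.filter (fun z => u z ∈ H)
  have hH0 : H0.image u = H := by
    rw [← hux]
    ext w
    simp [H0, ι']
  have hH0v : Finset.univ.image (fun z : ι' => v z) = H0.image v := by
    ext w
    simp [H0, ι']
  have hj : ∀ i, ∃ z : ι', u z = a i := fun i => by
    have h1 : a i ∈ H := haH (Finset.mem_image_of_mem a (Finset.mem_univ i))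
    obtain ⟨z, hz⟩ := hHim _ h1
    exact ⟨⟨z, hz ▸ h1⟩, hz⟩
  choose j' hj' using hj
  refine ⟨ι', inferInstance, fun z => u z, fun z => v z, j', v (j' (Fin.last r)), ?_, ?_, ?_⟩
  · refine ⟨hinj, fun z z' hz => Subtype.ext (hv hz), fun e => ?_, ?_, ?_, ?_⟩
    · have := huv (e.1, e.2.image Subtype.val)
      simp only [Finset.image_image] at this
      exact this
    · rw [← Finset.card_univ, ← Finset.card_image_of_injective _ hinj, hux]
      exact hHc
    · rw [hux]
      exact hH
    · rw [hH0v]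
      refine closedUpTo_of_subset hα (Finset.image_subset_image (Finset.subset_univ _)) hvc ?_
      intro Z hZ1 hZ2 hZc
      obtain ⟨S, -, rfl⟩ := Finset.subset_image_iff.1 hZ2
      have hS : H0 ⊆ S := (Finset.image_subset_image_iff hv).1 hZ1
      let E : Finset (Fin p × Finset (Fin b)) :=
        Finset.univ.filter (fun e => (e.1, e.2.image u) ∈ F)
      have hE : ∀ e, e ∈ E ↔ (e.1, e.2.image u) ∈ F := fun e => by simp [E]
      have hE' : ∀ T, PreservesEdges E F' T v := fun T e _ => (hE e).trans (huv e)
      have hEu : ∀ T, PreservesEdges E F T u := fun T e _ => hE e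
      rw [predim_image α (hE' _) hv.injOn, predim_image α (hE' _) hv.injOn,
        ← predim_image α (hEu _) hu.injOn, ← predim_image α (hEu _) hu.injOn, hH0]
      refine hH _ (hH0 ▸ Finset.image_subset_image hS) ?_
      rw [← Finset.image_sdiff _ _ hv, Finset.card_image_of_injective _ hv] at hZc
      rw [← hH0, ← Finset.image_sdiff _ _ hu, Finset.card_image_of_injective _ hu]
      exact hZc
  · funext i
    exact hj' i
  · funext i
    refine Fin.lastCases ?_ (fun i => ?_) i
    · simp
    · have h1 := hj' i.castSucc
      simp only [a, Fin.snoc_castSucc, Function.comp_apply] at h1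
      simp only [Function.comp_apply, Fin.snoc_castSucc]
      exact hxy _ _ h1

/-- The labelled hypergraph of a configuration. -/
def Config.edges {n : ℕ} (E : Config p n) : Finset (Fin p × Finset (Fin n)) :=
  Finset.univ.filter (fun e => E e.1 e.2 = true)

theorem Config.mem_edges {n : ℕ} {E : Config p n} {e : Fin p × Finset (Fin n)} :
    e ∈ Config.edges E ↔ E e.1 e.2 = true := by
  simp [Config.edges]

/-- Satisfaction of a bounded formula in the structure given by a configuration. -/
def realizeIn (k : Fin p → ℕ) {n : ℕ} (E : Config p n) {r : ℕ}
    (φ : (Lang p k).BoundedFormula Empty r) (v : Empty → Fin n) (a : Fin r → Fin n) : Prop :=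
  letI := structOf k n E; φ.Realize v a

theorem Lang.term_eq_var {k : Fin p → ℕ} {β : Type} (τ : (Lang p k).Term β) :
    ∃ i, τ = Language.Term.var i := by
  cases τ with
  | var i => exact ⟨i, rfl⟩
  | func f _ => exact f.elim

/-- Tuples from sufficiently closed common parts of sufficiently typical structures satisfy
the same formulas. -/
theorem exists_realize_iff (k : Fin p → ℕ) {α : Fin p → ℝ} (hα : ∀ i, 0 < α i) {r : ℕ}
    (φ : (Lang p k).BoundedFormula Empty r) :
    ∃ t : ℕ, ∀ s : ℕ, ∃ Q : ℕ, ∀ (n m : ℕ) (E : Config p n) (E' : Config p m),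
      Typical k α Q E.edges → Typical k α Q E'.edges →
      ∀ (ι : Type) [Fintype ι] (x : ι → Fin n) (y : ι → Fin m),
        CommonPart α s t E.edges E'.edges x y →
        ∀ (v : Empty → Fin n) (v' : Empty → Fin m) (j : Fin r → ι),
          realizeIn k E φ v (x ∘ j) ↔ realizeIn k E' φ v' (y ∘ j) := by
  induction φ with
  | falsum => exact ⟨0, fun s => ⟨0, fun _ _ _ _ _ _ _ _ _ _ _ _ _ _ => Iff.rfl⟩⟩
  | equal t₁ t₂ =>
    refine ⟨0, fun s => ⟨0, fun n m E E' _ _ ι _ x y h v v' j => ?_⟩⟩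
    obtain ⟨i₁, rfl⟩ := Lang.term_eq_var t₁
    obtain ⟨i₂, rfl⟩ := Lang.term_eq_var t₂
    rcases i₁ with i₁ | i₁
    · exact i₁.elim
    rcases i₂ with i₂ | i₂
    · exact i₂.elim
    simp only [realizeIn, Language.BoundedFormula.Realize, Language.Term.realize, Sum.elim_inr,
      Function.comp_apply]
    rw [h.inj_left.eq_iff, h.inj_right.eq_iff]
  | @rel r l R ts =>
    refine ⟨0, fun s => ⟨0, fun n m E E' _ _ ι _ x y h v v' j => ?_⟩⟩
    have hts : ∀ i, ∃ w, ts i = Language.Term.var (Sum.inr w) := by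
      intro i
      obtain ⟨w, hw⟩ := Lang.term_eq_var (ts i)
      rcases w with w | w
      · exact w.elim
      · exact ⟨w, hw⟩
    choose w hw using hts
    simp only [realizeIn, Language.BoundedFormula.Realize, hw, Language.Term.realize,
      Sum.elim_inr]
    have h1 : ∀ (V : Type) (z : ι → V), (fun i => (z ∘ j) (w i)) = z ∘ (j ∘ w) := fun V z => rfl
    change (Function.Injective (fun i => (x ∘ j) (w i)) ∧ E R.1 _ = true) ↔
      (Function.Injective (fun i => (y ∘ j) (w i)) ∧ E' R.1 _ = true)
    rw [h1, h1, h.inj_left.of_comp_iff, h.inj_right.of_comp_iff]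
    have h2 := h.edges (R.1, Finset.univ.image (j ∘ w))
    rw [Config.mem_edges, Config.mem_edges, Finset.image_image, Finset.image_image] at h2
    exact and_congr_right fun _ => h2
  | imp φ ψ ih₁ ih₂ =>
    obtain ⟨t₁, h₁⟩ := ih₁
    obtain ⟨t₂, h₂⟩ := ih₂
    refine ⟨max t₁ t₂, fun s => ?_⟩
    obtain ⟨Q₁, h₁⟩ := h₁ s
    obtain ⟨Q₂, h₂⟩ := h₂ s
    refine ⟨max Q₁ Q₂, fun n m E E' hE hE' ι _ x y h v v' j => ?_⟩
    have e₁ := h₁ n m E E' (hE.mono (le_max_left _ _)) (hE'.mono (le_max_left _ _)) ι x y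
      (h.mono (le_max_left _ _)) v v' j
    have e₂ := h₂ n m E E' (hE.mono (le_max_right _ _)) (hE'.mono (le_max_right _ _)) ι x y
      (h.mono (le_max_right _ _)) v v' j
    exact imp_congr e₁ e₂
  | @all r φ ih =>
    obtain ⟨t', h'⟩ := ih
    obtain ⟨N, hN⟩ := exists_closedUpTo (p := p) hα (r + 1) t'
    obtain ⟨Q', h'⟩ := h' N
    refine ⟨N + t', fun s => ⟨max Q' (max (s + N) t'), fun n m E E' hE hE' ι _ x y h v v' j => ?_⟩⟩
    have hQ1 : s + N ≤ max Q' (max (s + N) t') := by omega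
    have hQ2 : t' ≤ max Q' (max (s + N) t') := by omega
    have hQ3 : Q' ≤ max Q' (max (s + N) t') := by omega
    constructor
    · intro hall d
      obtain ⟨ι', _, y', x', j', c, hc, hy', hx'⟩ :=
        h.symm.forth hα hN hE' hE hQ1 hQ2 le_rfl j d
      have e := h' n m E E' (hE.mono hQ3) (hE'.mono hQ3) ι' x' y' hc.symm v v' j'
      rw [hx', hy'] at e
      exact e.1 (hall c)
    · intro hall c
      obtain ⟨ι', _, x', y', j', d, hc, hx', hy'⟩ :=
        h.forth hα hN hE hE' hQ1 hQ2 le_rfl j c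
      have e := h' n m E E' (hE.mono hQ3) (hE'.mono hQ3) ι' x' y' hc v v' j'
      rw [hx', hy'] at e
      exact e.2 (hall d)

/-- For every sentence, all sufficiently typical structures agree on it. -/
theorem exists_typical_realize_iff (k : Fin p → ℕ) {α : Fin p → ℝ} (hα : ∀ i, 0 < α i)
    (φ : (Lang p k).Sentence) :
    ∃ Q : ℕ, ∀ (n m : ℕ) (E : Config p n) (E' : Config p m),
      Typical k α Q E.edges → Typical k α Q E'.edges →
        (RealizeS k (Fin n) (structOf k n E) φ ↔ RealizeS k (Fin m) (structOf k m E') φ) := by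
  obtain ⟨t, ht⟩ := exists_realize_iff k hα φ
  obtain ⟨Q, hQ⟩ := ht 0
  refine ⟨max Q t, fun n m E E' hE hE' => ?_⟩
  have hclosed : ∀ {n : ℕ} {F : Finset (Fin p × Finset (Fin n))}, Typical k α (max Q t) F →
      ClosedUpTo α F t ∅ := by
    intro n F hF Z _ hZ
    have h1 := predim_le_card hα F ∅
    have h2 := hF.nonneg Z (by rw [Finset.sdiff_empty] at hZ; omega)
    simp at h1
    linarith
  have hc : CommonPart α 0 t E.edges E'.edges (fun i : Empty => i.elim) (fun i : Empty => i.elim) :=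
    { inj_left := fun i => i.elim
      inj_right := fun i => i.elim
      edges := fun e => by
        have h1 := hE.nonneg ∅ (by simp)
        have h2 := hE'.nonneg ∅ (by simp)
        have h3 : ∀ {n : ℕ} {F : Finset (Fin p × Finset (Fin n))}, 0 ≤ predim α F ∅ →
            ∀ i, (i, ∅) ∉ F := by
          intro n F h i hi
          have h4 : α i ≤ edgeWeight α (edgesIn F ∅) :=
            Finset.single_le_sum (f := fun e : Fin p × Finset (Fin n) => α e.1)
              (fun e _ => (hα e.1).le) (mem_edgesIn.2 ⟨hi, subset_rfl⟩)
          have h5 := hα i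
          simp only [predim, Finset.card_empty, Nat.cast_zero] at h
          linarith
        rw [Finset.eq_empty_of_isEmpty e.2, Finset.image_empty, Finset.image_empty]
        exact iff_of_false (h3 h1 _) (h3 h2 _)
      card_le := by simp
      closed_left := by simpa using hclosed hE
      closed_right := by simpa using hclosed hE' }
  have := hQ n m E E' (hE.mono (le_max_left _ _)) (hE'.mono (le_max_left _ _)) Empty _ _ hc
    default default Fin.elim0
  unfold realizeIn at this
  unfold RealizeS Language.Sentence.Realize Language.Formula.Realize
  convert this using 2

end BackAndForth

section Expectation

variable {β : Type*}

/-- The expectation of `h` at the random subset of `D` containing each `e` independently with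
probability `q e`. -/
noncomputable def expect (D : Finset β) (q : β → ℝ) (h : Finset β → ℝ) : ℝ :=
  ∑ F ∈ D.powerset, (∏ e ∈ D, if e ∈ F then q e else 1 - q e) * h F

/-- The probability of the event `P`. -/
noncomputable def prob (D : Finset β) (q : β → ℝ) (P : Finset β → Prop) : ℝ :=
  expect D q (fun F => if P F then 1 else 0)

variable {D : Finset β} {q : β → ℝ}

theorem expect_congr {f g : Finset β → ℝ} (h : ∀ F ⊆ D, f F = g F) :
    expect D q f = expect D q g :=
  Finset.sum_congr rfl fun F hF => by rw [h F (Finset.mem_powerset.1 hF)]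

theorem expect_mono (hq : ∀ e, 0 ≤ q e ∧ q e ≤ 1) {f g : Finset β → ℝ}
    (h : ∀ F ⊆ D, f F ≤ g F) : expect D q f ≤ expect D q g := by
  refine Finset.sum_le_sum fun F hF => mul_le_mul_of_nonneg_left (h F (Finset.mem_powerset.1 hF))
    (Finset.prod_nonneg fun e _ => ?_)
  split_ifs
  · exact (hq e).1
  · linarith [(hq e).2]

theorem expect_add (f g : Finset β → ℝ) :
    expect D q (fun F => f F + g F) = expect D q f + expect D q g := by
  simp only [expect, mul_add, Finset.sum_add_distrib]

theorem expect_mul_left (c : ℝ) (f : Finset β → ℝ) :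
    expect D q (fun F => c * f F) = c * expect D q f := by
  simp only [expect, Finset.mul_sum]
  exact Finset.sum_congr rfl fun F _ => by ring

theorem expect_mul_right (c : ℝ) (f : Finset β → ℝ) :
    expect D q (fun F => f F * c) = expect D q f * c := by
  simp only [mul_comm _ c, expect_mul_left]

theorem expect_sum {κ : Type*} (s : Finset κ) (f : κ → Finset β → ℝ) :
    expect D q (fun F => ∑ j ∈ s, f j F) = ∑ j ∈ s, expect D q (f j) := by
  simp only [expect, Finset.mul_sum]
  exact Finset.sum_comm

theorem expect_const (c : ℝ) : expect D q (fun _ => c) = c := by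
  have h := Finset.prod_add q (fun e => 1 - q e) D
  simp only [add_sub_cancel, Finset.prod_const_one] at h
  unfold expect
  rw [← Finset.sum_mul]
  refine (congrArg (· * c) (Eq.trans (Finset.sum_congr rfl fun F hF => ?_) h.symm)).trans
    (one_mul c)
  rw [Finset.prod_ite]
  congr 1
  · refine Finset.prod_congr ?_ fun _ _ => rfl
    ext e
    simp only [Finset.mem_filter]
    exact ⟨fun h => h.2, fun h => ⟨Finset.mem_powerset.1 hF h, h⟩⟩
  · refine Finset.prod_congr ?_ fun _ _ => rfl
    ext e
    simp

theorem expect_union {D₁ D₂ : Finset β} (hd : Disjoint D₁ D₂) (h : Finset β → ℝ) :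
    expect (D₁ ∪ D₂) q h =
      expect D₁ q (fun F₁ => expect D₂ q (fun F₂ => h (F₁ ∪ F₂))) := by
  simp only [expect, Finset.mul_sum]
  rw [← Finset.sum_product']
  refine Finset.sum_nbij' (fun F => (F ∩ D₁, F ∩ D₂)) (fun F => F.1 ∪ F.2) ?_ ?_ ?_ ?_ ?_
  · intro F _
    simp [Finset.inter_subset_right]
  · rintro ⟨F₁, F₂⟩ hF
    simp only [Finset.mem_product, Finset.mem_powerset] at hF ⊢
    exact Finset.union_subset_union hF.1 hF.2
  · intro F hF
    rw [Finset.mem_powerset] at hF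
    simp only
    rw [← Finset.inter_union_distrib_left, Finset.inter_eq_left.2 hF]
  · rintro ⟨F₁, F₂⟩ hF
    simp only [Finset.mem_product, Finset.mem_powerset] at hF
    have h1 : F₂ ∩ D₁ = ∅ := Finset.disjoint_iff_inter_eq_empty.1 (hd.symm.mono_left hF.2)
    have h2 : F₁ ∩ D₂ = ∅ := Finset.disjoint_iff_inter_eq_empty.1 (hd.mono_left hF.1)
    simp only [Finset.union_inter_distrib_right, h1, h2, Finset.inter_eq_left.2 hF.1,
      Finset.inter_eq_left.2 hF.2, Finset.union_empty, Finset.empty_union]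
  · intro F hF
    rw [Finset.mem_powerset] at hF
    simp only
    rw [← Finset.inter_union_distrib_left, Finset.inter_eq_left.2 hF, Finset.prod_union hd,
      mul_assoc]
    congr 1
    · refine Finset.prod_congr rfl fun e he => ?_
      simp [he]
    · congr 1
      refine Finset.prod_congr rfl fun e he => ?_
      simp [he]

theorem prob_subset {S : Finset β} (hS : S ⊆ D) :
    prob D q (fun F => S ⊆ F) = ∏ e ∈ S, q e := by
  unfold prob
  rw [← Finset.union_sdiff_of_subset hS, expect_union Finset.disjoint_sdiff]
  have h1 : ∀ F₁ ⊆ S, expect (D \ S) q (fun F₂ => if S ⊆ F₁ ∪ F₂ then (1 : ℝ) else 0) =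
      if F₁ = S then 1 else 0 := by
    intro F₁ hF₁
    rw [← expect_const (D := D \ S) (q := q) (if F₁ = S then (1 : ℝ) else 0)]
    refine expect_congr fun F₂ hF₂ => if_congr ⟨fun h => ?_, fun h => ?_⟩ rfl rfl
    · refine hF₁.antisymm fun e he => ?_
      rcases Finset.mem_union.1 (h he) with h2 | h2
      · exact h2
      · exact absurd he (Finset.mem_sdiff.1 (hF₂ h2)).2
    · rw [h]
      exact Finset.subset_union_left
  refine (expect_congr (g := fun F₁ => if F₁ = S then 1 else 0) fun F₁ hF₁ => ?_).trans ?_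
  · convert h1 F₁ hF₁
  unfold expect
  rw [Finset.sum_eq_single S]
  · simp only [if_true, mul_one]
    exact Finset.prod_congr rfl fun e he => by simp [he]
  · intro F _ hF
    simp [hF]
  · simp

theorem expect_mul_of_local {R : Finset β} {f g : Finset β → ℝ} (hf : ∀ F, f (F ∩ R) = f F)
    (hg : ∀ F, g (F \ R) = g F) :
    expect D q (fun F => f F * g F) = expect D q f * expect D q g := by
  have hD : D = (D ∩ R) ∪ (D \ R) := (sup_inf_sdiff D R).symm
  have hdis : Disjoint (D ∩ R) (D \ R) := by
    rw [Finset.disjoint_left]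
    intro e h1 h2
    exact (Finset.mem_sdiff.1 h2).2 (Finset.mem_inter.1 h1).2
  have h1 : ∀ F₁ ⊆ D ∩ R, ∀ F₂ ⊆ D \ R, f (F₁ ∪ F₂) = f F₁ := by
    intro F₁ h₁ F₂ h₂
    rw [← hf, ← hf F₁]
    congr 1
    ext e
    simp only [Finset.mem_inter, Finset.mem_union]
    constructor
    · rintro ⟨h | h, hR⟩
      · exact ⟨h, hR⟩
      · exact absurd hR (Finset.mem_sdiff.1 (h₂ h)).2
    · rintro ⟨h, hR⟩
      exact ⟨Or.inl h, hR⟩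
  have h2 : ∀ F₁ ⊆ D ∩ R, ∀ F₂ ⊆ D \ R, g (F₁ ∪ F₂) = g F₂ := by
    intro F₁ h₁ F₂ h₂
    rw [← hg, ← hg F₂]
    congr 1
    ext e
    simp only [Finset.mem_sdiff, Finset.mem_union]
    constructor
    · rintro ⟨h | h, hR⟩
      · exact absurd (Finset.mem_inter.1 (h₁ h)).2 hR
      · exact ⟨h, hR⟩
    · rintro ⟨h, hR⟩
      exact ⟨Or.inr h, hR⟩
  have h3 : expect D q f = expect (D ∩ R) q f := by
    conv_lhs => rw [hD, expect_union hdis]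
    exact expect_congr fun F₁ hF₁ => by
      rw [expect_congr (h1 F₁ hF₁), expect_const]
  have h4 : expect D q g = expect (D \ R) q g := by
    conv_lhs => rw [hD, expect_union hdis]
    rw [expect_congr (g := fun _ => expect (D \ R) q g) fun F₁ hF₁ => expect_congr (h2 F₁ hF₁),
      expect_const]
  rw [h3, h4]
  conv_lhs => rw [hD, expect_union hdis]
  rw [← expect_mul_right]
  refine expect_congr fun F₁ hF₁ => ?_
  rw [← expect_mul_left]
  exact expect_congr fun F₂ hF₂ => by rw [h1 F₁ hF₁ F₂ hF₂, h2 F₁ hF₁ F₂ hF₂]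

theorem expect_prod_of_local {κ : Type*} (J : Finset κ) (R : κ → Finset β)
    (f : κ → Finset β → ℝ) (hR : ∀ i ∈ J, ∀ j ∈ J, i ≠ j → Disjoint (R i) (R j))
    (hf : ∀ j F, f j (F ∩ R j) = f j F) :
    expect D q (fun F => ∏ j ∈ J, f j F) = ∏ j ∈ J, expect D q (f j) := by
  induction J using Finset.induction_on with
  | empty => simp [expect_const]
  | insert i J hi ih =>
    simp only [Finset.prod_insert hi]
    rw [expect_mul_of_local (R := R i) (hf i), ih fun a ha b hb =>
      hR a (Finset.mem_insert_of_mem ha) b (Finset.mem_insert_of_mem hb)]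
    intro F
    refine Finset.prod_congr rfl fun j hj => ?_
    rw [← hf j (F \ R i), ← hf j F]
    congr 1
    ext e
    simp only [Finset.mem_inter, Finset.mem_sdiff]
    have := Finset.disjoint_left.1 (hR i (Finset.mem_insert_self _ _) j
      (Finset.mem_insert_of_mem hj) (fun h => hi (h ▸ hj)))
    exact ⟨fun h => ⟨h.1.1, h.2⟩, fun h => ⟨⟨h.1, fun h' => this h' h.2⟩, h.2⟩⟩

theorem prob_nonneg (hq : ∀ e, 0 ≤ q e ∧ q e ≤ 1) (P : Finset β → Prop) : 0 ≤ prob D q P := by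
  rw [← expect_const (D := D) (q := q) 0]
  refine expect_mono hq fun F _ => ?_
  split_ifs <;> simp

theorem prob_mono (hq : ∀ e, 0 ≤ q e ∧ q e ≤ 1) {P Q : Finset β → Prop}
    (h : ∀ F ⊆ D, P F → Q F) : prob D q P ≤ prob D q Q := by
  refine expect_mono hq fun F hF => ?_
  by_cases hP : P F
  · simp [hP, h F hF hP]
  · simp only [hP, if_false]
    split_ifs <;> simp

theorem prob_le_expect (hq : ∀ e, 0 ≤ q e ∧ q e ≤ 1) {P : Finset β → Prop} {f : Finset β → ℝ}
    (hf : ∀ F ⊆ D, 0 ≤ f F) (h : ∀ F ⊆ D, P F → 1 ≤ f F) : prob D q P ≤ expect D q f := by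
  refine expect_mono hq fun F hF => ?_
  by_cases hP : P F
  · simp [hP, h F hF hP]
  · simp [hP, hf F hF]

theorem prob_le_sum (hq : ∀ e, 0 ≤ q e ∧ q e ≤ 1) {κ : Type*} (s : Finset κ)
    {P : Finset β → Prop} (Q : κ → Finset β → Prop) (h : ∀ F ⊆ D, P F → ∃ j ∈ s, Q j F) :
    prob D q P ≤ ∑ j ∈ s, prob D q (Q j) := by
  unfold prob
  rw [← expect_sum]
  refine prob_le_expect hq (fun F _ => Finset.sum_nonneg fun j _ => ?_) fun F hF hP => ?_
  · split_ifs <;> simp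
  · obtain ⟨j, hj, hQ⟩ := h F hF hP
    calc (1 : ℝ) = if Q j F then 1 else 0 := by simp [hQ]
      _ ≤ _ := Finset.single_le_sum (f := fun j => if Q j F then (1 : ℝ) else 0)
        (fun j _ => by split_ifs <;> simp) hj

theorem prob_le_add (hq : ∀ e, 0 ≤ q e ∧ q e ≤ 1) {P Q R : Finset β → Prop}
    (h : ∀ F ⊆ D, P F → Q F ∨ R F) : prob D q P ≤ prob D q Q + prob D q R := by
  unfold prob
  rw [← expect_add]
  refine prob_le_expect hq (fun F _ => add_nonneg ?_ ?_) fun F hF hP => ?_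
  · split_ifs <;> simp
  · split_ifs <;> simp
  · rcases h F hF hP with h | h
    · simp only [h, if_true, le_add_iff_nonneg_right]
      split_ifs <;> simp
    · simp only [h, if_true, le_add_iff_nonneg_left]
      split_ifs <;> simp

theorem prob_not (P : Finset β → Prop) : prob D q (fun F => ¬ P F) = 1 - prob D q P := by
  have h : prob D q (fun F => ¬ P F) + prob D q P = 1 := by
    unfold prob
    rw [← expect_add]
    refine (expect_congr (g := fun _ => 1) fun F _ => ?_).trans (expect_const 1)
    by_cases hP : P F <;> simp [hP]
  linarith

end Expectation

section RandomHypergraph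

/-- The potential edges on `{0, …, n - 1}`. -/
def potentialEdges (k : Fin p → ℕ) (n : ℕ) : Finset (Fin p × Finset (Fin n)) :=
  Finset.univ.filter (fun e => e.2.card = k e.1)

/-- The probability of the edge `e`. -/
noncomputable def edgeProb (α γ : Fin p → ℝ) (n : ℕ) (e : Fin p × Finset (Fin n)) : ℝ :=
  γ e.1 * (n : ℝ) ^ (-(α e.1))

/-- The probability of an event about the random labelled hypergraph. -/
noncomputable def hprob (k : Fin p → ℕ) (α γ : Fin p → ℝ) (n : ℕ)
    (P : Finset (Fin p × Finset (Fin n)) → Prop) : ℝ :=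
  prob (potentialEdges k n) (edgeProb α γ n) P

theorem mem_potentialEdges {k : Fin p → ℕ} {n : ℕ} {e : Fin p × Finset (Fin n)} :
    e ∈ potentialEdges k n ↔ e.2.card = k e.1 := by
  simp [potentialEdges]

theorem arityValid_iff {k : Fin p → ℕ} {n : ℕ} {F : Finset (Fin p × Finset (Fin n))} :
    ArityValid k F ↔ F ⊆ potentialEdges k n :=
  ⟨fun h e he => mem_potentialEdges.2 (h e he), fun h _ he => mem_potentialEdges.1 (h he)⟩

/-- The configuration with a given set of edges. -/
noncomputable def configOf {n : ℕ} (F : Finset (Fin p × Finset (Fin n))) : Config p n :=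
  fun i C => decide ((i, C) ∈ F)

theorem edges_configOf {n : ℕ} (F : Finset (Fin p × Finset (Fin n))) :
    (configOf F).edges = F := by
  ext e
  simp [Config.mem_edges, configOf]

theorem configOf_edges {n : ℕ} (E : Config p n) : configOf E.edges = E := by
  funext i C
  simp [configOf, Config.mem_edges]

theorem Pev_eq_hprob (k : Fin p → ℕ) (α γ : Fin p → ℝ) (n : ℕ) (Q : Config p n → Prop) :
    Pev k α γ n Q = hprob k α γ n (fun F => Q (configOf F)) := by
  unfold Pev hprob prob expect
  refine Finset.sum_nbij' (fun E => E.edges) configOf ?_ ?_ ?_ ?_ ?_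
  · intro E hE
    refine Finset.mem_powerset.2 fun e he => mem_potentialEdges.2 ?_
    exact (Finset.mem_filter.1 hE).2 e.1 e.2 (Config.mem_edges.1 he)
  · intro F hF
    refine Finset.mem_filter.2 ⟨Finset.mem_univ _, fun i C hC => ?_⟩
    exact mem_potentialEdges.1 (Finset.mem_powerset.1 hF (by simpa [configOf] using hC))
  · intro E _
    exact configOf_edges E
  · intro F _
    exact edges_configOf F
  · intro E _
    have h : weight k α γ n E = ∏ e ∈ potentialEdges k n,
        if e ∈ E.edges then edgeProb α γ n e else 1 - edgeProb α γ n e := by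
      unfold weight potentialEdges
      rw [Finset.prod_filter, Fintype.prod_prod_type]
      refine Finset.prod_congr rfl fun i _ => ?_
      rw [Finset.prod_filter]
      refine Finset.prod_congr rfl fun C _ => ?_
      simp only [Config.mem_edges]
      rfl
    simp only [configOf_edges, h, mul_ite, mul_one, mul_zero]
    congr! 3

theorem edgeProb_mem {α γ : Fin p → ℝ} (hα : ∀ i, 0 < α i) (hγ : ∀ i, 0 < γ i ∧ γ i ≤ 1) {n : ℕ}
    (hn : 0 < n) (e : Fin p × Finset (Fin n)) :
    0 < edgeProb α γ n e ∧ edgeProb α γ n e ≤ 1 := by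
  have hn' : (1 : ℝ) ≤ n := by exact_mod_cast hn
  refine ⟨mul_pos (hγ e.1).1 (Real.rpow_pos_of_pos (by linarith) _), ?_⟩
  have h1 : (n : ℝ) ^ (-(α e.1)) ≤ 1 :=
    Real.rpow_le_one_of_one_le_of_nonpos hn' (by linarith [hα e.1])
  have h2 : 0 ≤ (n : ℝ) ^ (-(α e.1)) := Real.rpow_nonneg (by linarith) _
  exact mul_le_one₀ (hγ e.1).2 h2 h1

theorem prod_edgeProb {α γ : Fin p → ℝ} {n : ℕ} (hn : 0 < n)
    (S : Finset (Fin p × Finset (Fin n))) :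
    ∏ e ∈ S, edgeProb α γ n e = (∏ e ∈ S, γ e.1) * (n : ℝ) ^ (-edgeWeight α S) := by
  have hn' : (0 : ℝ) < n := by exact_mod_cast hn
  unfold edgeProb edgeWeight
  rw [Finset.prod_mul_distrib, ← Finset.sum_neg_distrib, Real.rpow_sum_of_pos hn']

theorem prod_edgeProb_le {α γ : Fin p → ℝ} (hγ : ∀ i, 0 < γ i ∧ γ i ≤ 1) {n : ℕ} (hn : 0 < n)
    (S : Finset (Fin p × Finset (Fin n))) :
    ∏ e ∈ S, edgeProb α γ n e ≤ (n : ℝ) ^ (-edgeWeight α S) := by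
  rw [prod_edgeProb hn]
  refine mul_le_of_le_one_left (Real.rpow_nonneg (Nat.cast_nonneg _) _) ?_
  exact Finset.prod_le_one (fun e _ => (hγ e.1).1.le) fun e _ => (hγ e.1).2

end RandomHypergraph

section FirstMoment

variable {k : Fin p → ℕ} {α γ : Fin p → ℝ} {n : ℕ}

theorem edgeProb_mem_Icc (hα : ∀ i, 0 < α i) (hγ : ∀ i, 0 < γ i ∧ γ i ≤ 1) (hn : 0 < n)
    (e : Fin p × Finset (Fin n)) : 0 ≤ edgeProb α γ n e ∧ edgeProb α γ n e ≤ 1 :=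
  ⟨(edgeProb_mem hα hγ hn e).1.le, (edgeProb_mem hα hγ hn e).2⟩

theorem hprob_le_edgeWeight (hα : ∀ i, 0 < α i) (hγ : ∀ i, 0 < γ i ∧ γ i ≤ 1) (hn : 0 < n)
    {D : Finset (Fin p × Finset (Fin n))} (hD : D ⊆ potentialEdges k n) {m : ℕ} (hm : D.card ≤ m)
    (c : ℝ) :
    hprob k α γ n (fun F => c ≤ edgeWeight α (F ∩ D)) ≤ 2 ^ m * (n : ℝ) ^ (-c) := by
  have hn' : (1 : ℝ) ≤ n := by exact_mod_cast hn
  have h0 : (0 : ℝ) ≤ (n : ℝ) ^ (-c) := Real.rpow_nonneg (by linarith) _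
  calc hprob k α γ n (fun F => c ≤ edgeWeight α (F ∩ D))
      ≤ ∑ T ∈ D.powerset.filter (fun T => c ≤ edgeWeight α T),
          hprob k α γ n (fun F => T ⊆ F) := by
        refine prob_le_sum (edgeProb_mem_Icc hα hγ hn) _ _ fun F _ h => ⟨F ∩ D, ?_, ?_⟩
        · exact Finset.mem_filter.2 ⟨Finset.mem_powerset.2 Finset.inter_subset_right, h⟩
        · exact Finset.inter_subset_left
    _ ≤ ∑ T ∈ D.powerset.filter (fun T => c ≤ edgeWeight α T), (n : ℝ) ^ (-c) := by
        refine Finset.sum_le_sum fun T hT => ?_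
        rw [Finset.mem_filter, Finset.mem_powerset] at hT
        unfold hprob
        rw [prob_subset (hT.1.trans hD)]
        exact (prod_edgeProb_le hγ hn T).trans
          (Real.rpow_le_rpow_of_exponent_le hn' (neg_le_neg hT.2))
    _ ≤ ∑ T ∈ D.powerset, (n : ℝ) ^ (-c) :=
        Finset.sum_le_sum_of_subset_of_nonneg (Finset.filter_subset _ _) fun _ _ _ => h0
    _ = 2 ^ D.card * (n : ℝ) ^ (-c) := by simp
    _ ≤ _ := by gcongr; norm_num

theorem card_edges_within_le {l : ℕ} {W : Finset (Fin n)} (hW : W.card ≤ l)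
    {D : Finset (Fin p × Finset (Fin n))} (hD : ∀ e ∈ D, e.2 ⊆ W) : D.card ≤ p * 2 ^ l := by
  calc D.card ≤ ((Finset.univ : Finset (Fin p)) ×ˢ W.powerset).card :=
        Finset.card_le_card fun e he => by simp [hD e he]
    _ = p * 2 ^ W.card := by simp
    _ ≤ _ := by gcongr; norm_num

theorem sum_rpow_card_le (hn : 0 < n) (l : ℕ) (c : ℝ) :
    ∑ S ∈ (Finset.univ : Finset (Finset (Fin n))).filter (fun S => S.card ≤ l),
      (n : ℝ) ^ (c - (S.card : ℝ)) ≤ (l + 1) * (n : ℝ) ^ c := by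
  have hn' : (0 : ℝ) < n := by exact_mod_cast hn
  rw [← Finset.sum_fiberwise_of_maps_to (t := Finset.range (l + 1)) (g := Finset.card)
    fun S hS => Finset.mem_range.2 (Nat.lt_succ_of_le (Finset.mem_filter.1 hS).2)]
  refine (Finset.sum_le_card_nsmul _ _ ((n : ℝ) ^ c) fun j _ => ?_).trans_eq (by simp)
  calc _ ≤ ∑ S ∈ Finset.powersetCard j (Finset.univ : Finset (Fin n)),
          (n : ℝ) ^ (c - (S.card : ℝ)) := by
        refine Finset.sum_le_sum_of_subset_of_nonneg (fun S hS => ?_) fun _ _ _ =>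
          Real.rpow_nonneg hn'.le _
        exact Finset.mem_powersetCard.2 ⟨Finset.subset_univ _, (Finset.mem_filter.1 hS).2⟩
    _ = (n.choose j : ℝ) * (n : ℝ) ^ (c - (j : ℝ)) := by
        rw [Finset.sum_congr rfl (g := fun _ => (n : ℝ) ^ (c - (j : ℝ)))
          (fun S hS => by rw [(Finset.mem_powersetCard.1 hS).2])]
        simp
    _ ≤ (n : ℝ) ^ j * (n : ℝ) ^ (c - (j : ℝ)) := by
        gcongr
        exact_mod_cast Nat.choose_le_pow n j
    _ = (n : ℝ) ^ c := by
        rw [← Real.rpow_natCast, ← Real.rpow_add hn']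
        congr 1
        ring

theorem sum_hprob_predim_le (hα : ∀ i, 0 < α i) (hγ : ∀ i, 0 < γ i ∧ γ i ≤ 1) (hn : 0 < n)
    {b l : ℕ} {X : Finset (Fin n)} (hX : X.card ≤ b) (θ : ℝ) :
    ∑ W ∈ (Finset.univ : Finset (Finset (Fin n))).filter (fun W => X ⊆ W ∧ (W \ X).card ≤ l),
      hprob k α γ n (fun F => predim α F W ≤ predim α F X + θ) ≤
        (2 ^ (p * 2 ^ (b + l)) * (l + 1)) * (n : ℝ) ^ θ := by
  set s := (Finset.univ : Finset (Finset (Fin n))).filter (fun W => X ⊆ W ∧ (W \ X).card ≤ l)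
  have h1 : ∀ W ∈ s, hprob k α γ n (fun F => predim α F W ≤ predim α F X + θ) ≤
      2 ^ (p * 2 ^ (b + l)) * (n : ℝ) ^ (θ - ((W \ X).card : ℝ)) := by
    intro W hW
    obtain ⟨-, hXW, hl⟩ := Finset.mem_filter.1 hW
    let D := (potentialEdges k n).filter (fun e => e.2 ⊆ W ∧ ¬ e.2 ⊆ X)
    have hD : D.card ≤ p * 2 ^ (b + l) := by
      refine card_edges_within_le (W := W) ?_ fun e he => (Finset.mem_filter.1 he).2.1
      have := Finset.card_sdiff_add_card_eq_card hXW
      omega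
    refine le_trans ?_ ((hprob_le_edgeWeight hα hγ hn (Finset.filter_subset _ _) hD
      (((W \ X).card : ℝ) - θ)).trans_eq (by rw [neg_sub]))
    refine prob_mono (edgeProb_mem_Icc hα hγ hn) fun F hF h => ?_
    have h2 := predim_sub α F hXW
    have h3 : edgesIn F W \ edgesIn F X = F ∩ D := by
      ext e
      simp only [Finset.mem_sdiff, mem_edgesIn, Finset.mem_inter, D, Finset.mem_filter]
      constructor
      · rintro ⟨⟨h4, h5⟩, h6⟩
        exact ⟨h4, hF h4, h5, fun h7 => h6 ⟨h4, h7⟩⟩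
      · rintro ⟨h4, -, h5, h6⟩
        exact ⟨⟨h4, h5⟩, fun h7 => h6 h7.2⟩
    rw [h3] at h2
    linarith
  calc _ ≤ ∑ W ∈ s, 2 ^ (p * 2 ^ (b + l)) * (n : ℝ) ^ (θ - ((W \ X).card : ℝ)) :=
        Finset.sum_le_sum h1
    _ = 2 ^ (p * 2 ^ (b + l)) * ∑ S ∈ s.image (fun W => W \ X),
          (n : ℝ) ^ (θ - (S.card : ℝ)) := by
        rw [← Finset.mul_sum, Finset.sum_image]
        intro W hW W' hW' h
        have h2 := (Finset.mem_filter.1 hW).2.1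
        have h3 := (Finset.mem_filter.1 hW').2.1
        rw [← Finset.sdiff_union_of_subset h2, ← Finset.sdiff_union_of_subset h3]
        exact congrArg (· ∪ X) h
    _ ≤ 2 ^ (p * 2 ^ (b + l)) * ((l + 1) * (n : ℝ) ^ θ) := by
        refine mul_le_mul_of_nonneg_left (le_trans ?_ (sum_rpow_card_le hn l θ)) (by positivity)
        refine Finset.sum_le_sum_of_subset_of_nonneg ?_ fun _ _ _ =>
          Real.rpow_nonneg (Nat.cast_nonneg _) _
        intro S hS
        obtain ⟨W, hW, rfl⟩ := Finset.mem_image.1 hS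
        exact Finset.mem_filter.2 ⟨Finset.mem_univ _, (Finset.mem_filter.1 hW).2.2⟩
    _ = _ := by ring

theorem tendsto_hprob_exists_predim_neg (k : Fin p → ℕ) (hα : ∀ i, 0 < α i)
    (hγ : ∀ i, 0 < γ i ∧ γ i ≤ 1) (Q : ℕ) :
    Tendsto (fun n => hprob k α γ n (fun F => ∃ X : Finset (Fin n), X.card ≤ Q ∧
      predim α F X < 0)) atTop (𝓝 0) := by
  obtain ⟨ε, hε, hgap⟩ := exists_gap hα 0 Q
  have h1 : ∀ n : ℕ, 0 < n → hprob k α γ n (fun F => ∃ X : Finset (Fin n), X.card ≤ Q ∧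
      predim α F X < 0) ≤ 2 ^ (p * 2 ^ Q) * (Q + 1) * (n : ℝ) ^ (-ε) := by
    intro n hn
    calc _ ≤ ∑ X ∈ (Finset.univ : Finset (Finset (Fin n))).filter (fun X => X.card ≤ Q),
          hprob k α γ n (fun F => predim α F X < 0) :=
          prob_le_sum (edgeProb_mem_Icc hα hγ hn) _ _ fun F _ ⟨X, hX, h⟩ =>
            ⟨X, Finset.mem_filter.2 ⟨Finset.mem_univ _, hX⟩, h⟩
      _ ≤ ∑ X ∈ (Finset.univ : Finset (Finset (Fin n))).filter (fun X => X.card ≤ Q),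
          2 ^ (p * 2 ^ Q) * (n : ℝ) ^ (-ε - (X.card : ℝ)) := by
          refine Finset.sum_le_sum fun X hX => ?_
          have hX := (Finset.mem_filter.1 hX).2
          let D := edgesIn (potentialEdges k n) X
          have hD : D.card ≤ p * 2 ^ Q :=
            card_edges_within_le hX fun e he => (mem_edgesIn.1 he).2
          refine le_trans ?_ ((hprob_le_edgeWeight hα hγ hn (Finset.filter_subset _ _) hD
            ((X.card : ℝ) + ε)).trans_eq (by congr 2; ring))
          refine prob_mono (edgeProb_mem_Icc hα hγ hn) fun F hF h => ?_
          have h2 : F ∩ D = edgesIn F X := by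
            ext e
            simp only [Finset.mem_inter, D, mem_edgesIn]
            exact ⟨fun h => ⟨h.1, h.2.2⟩, fun h => ⟨h.1, hF h.1, h.2⟩⟩
          unfold predim at h
          rw [edgeWeight_eq] at h
          have h3 := hgap _ _ hX h
          rw [← edgeWeight_eq] at h3
          change _ ≤ edgeWeight α (F ∩ D)
          rw [h2]
          linarith
      _ ≤ _ := by
          rw [← Finset.mul_sum, mul_assoc]
          exact mul_le_mul_of_nonneg_left (sum_rpow_card_le hn Q (-ε)) (by positivity)
  refine squeeze_zero' ?_ ((eventually_gt_atTop 0).mono h1) ?_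
  · exact (eventually_gt_atTop 0).mono fun n hn => prob_nonneg (edgeProb_mem_Icc hα hγ hn) _
  · have := ((tendsto_rpow_neg_atTop hε).comp tendsto_natCast_atTop_atTop).const_mul
      ((2 : ℝ) ^ (p * 2 ^ Q) * (Q + 1))
    simpa using this

end FirstMoment

section SecondMoment

variable {β : Type*} {D : Finset β} {q : β → ℝ}

theorem sum_pow_card_agree_le (U : Type*) [Fintype U] (N : ℕ) :
    ∑ c : U → Fin N, ∑ c' : U → Fin N,
      (N : ℝ) ^ (Finset.univ.filter (fun u => c u = c' u)).card ≤
        2 ^ Fintype.card U * ((N : ℝ) ^ Fintype.card U) ^ 2 := by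
  have h : ∀ c : U → Fin N, ∑ c' : U → Fin N,
      (N : ℝ) ^ (Finset.univ.filter (fun u => c u = c' u)).card ≤
        (2 * (N : ℝ)) ^ Fintype.card U := by
    intro c
    have h1 : ∀ c' : U → Fin N, (N : ℝ) ^ (Finset.univ.filter (fun u => c u = c' u)).card =
        ∏ u, if c u = c' u then (N : ℝ) else 1 := by
      intro c'
      rw [Finset.prod_ite]
      simp
    rw [Finset.sum_congr rfl fun c' _ => h1 c',
      ← Fintype.prod_sum (fun u (v : Fin N) => if c u = v then (N : ℝ) else 1)]
    refine (Finset.prod_le_prod (g := fun _ => 2 * (N : ℝ)) (fun u _ => Finset.sum_nonneg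
      fun v _ => ?_) fun u _ => ?_).trans_eq ?_
    · split_ifs <;> positivity
    · have h2 : ∀ v : Fin N, (if c u = v then (N : ℝ) else 1) ≤
          (if c u = v then (N : ℝ) else 0) + 1 := by
        intro v
        split_ifs <;> linarith
      refine (Finset.sum_le_sum fun v _ => h2 v).trans_eq ?_
      rw [Finset.sum_add_distrib, Finset.sum_ite_eq]
      simp
      ring
    · simp
  refine (Finset.sum_le_sum fun c _ => h c).trans_eq ?_
  simp [mul_pow]
  ring

theorem expect_sq_sub_le (hq : ∀ e, 0 < q e ∧ q e ≤ 1) {U : Type*} [Fintype U] {N : ℕ}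
    (S : (U → Fin N) → Finset β) (hS : ∀ c, S c ⊆ D) {P η : ℝ} (hP : ∀ c, ∏ e ∈ S c, q e = P)
    (hη : 0 ≤ η)
    (h : ∀ c c', Disjoint (S c) (S c') ∨ 1 ≤ η * (∏ e ∈ S c ∩ S c', q e) *
      (N : ℝ) ^ (Finset.univ.filter (fun u => c u = c' u)).card) :
    expect D q (fun F => (((Finset.univ.filter (fun c => S c ⊆ F)).card : ℝ) -
      (N : ℝ) ^ Fintype.card U * P) ^ 2) ≤
        2 ^ Fintype.card U * η * ((N : ℝ) ^ Fintype.card U * P) ^ 2 := by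
  set μ := (N : ℝ) ^ Fintype.card U * P with hμ
  let I : (U → Fin N) → Finset β → ℝ := fun c F => if S c ⊆ F then 1 else 0
  have hI : ∀ c, expect D q (I c) = P := fun c => by
    rw [← hP c, ← prob_subset (hS c)]
    exact expect_congr fun F _ => by simp [I]
  have hII : ∀ c c', expect D q (fun F => I c F * I c' F) = ∏ e ∈ S c ∪ S c', q e := by
    intro c c'
    rw [← prob_subset (Finset.union_subset (hS c) (hS c'))]
    refine expect_congr fun F _ => ?_
    simp only [I, Finset.union_subset_iff]
    by_cases h1 : S c ⊆ F <;> by_cases h2 : S c' ⊆ F <;> simp [h1, h2]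
  have hle : ∀ c c', expect D q (fun F => I c F * I c' F) ≤ P ^ 2 + η * P ^ 2 *
      (N : ℝ) ^ (Finset.univ.filter (fun u => c u = c' u)).card := by
    intro c c'
    have h1 := Finset.prod_union_inter (s₁ := S c) (s₂ := S c') (f := q)
    rw [hP, hP, ← sq] at h1
    rw [hII]
    have h2 : 0 ≤ ∏ e ∈ S c ∪ S c', q e := Finset.prod_nonneg fun e _ => (hq e).1.le
    rcases h c c' with h3 | h3
    · rw [Finset.disjoint_iff_inter_eq_empty.1 h3, Finset.prod_empty, mul_one] at h1
      rw [h1]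
      have : 0 ≤ η * P ^ 2 * (N : ℝ) ^ (Finset.univ.filter (fun u => c u = c' u)).card := by
        positivity
      linarith
    · have h4 := mul_le_mul_of_nonneg_left h3 h2
      have h5 : 0 ≤ P ^ 2 := sq_nonneg P
      calc _ ≤ _ := (mul_one _).symm.le.trans h4
        _ = η * P ^ 2 * (N : ℝ) ^ (Finset.univ.filter (fun u => c u = c' u)).card := by
          rw [← h1]
          ring
        _ ≤ _ := by linarith
  have hexp : ∀ F, (((Finset.univ.filter (fun c => S c ⊆ F)).card : ℝ) - μ) ^ 2 =
      (∑ c, ∑ c', I c F * I c' F) + ((-2 * μ) * (∑ c, I c F) + μ ^ 2) := by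
    intro F
    have h1 : ((Finset.univ.filter (fun c => S c ⊆ F)).card : ℝ) = ∑ c, I c F := by
      simp [I]
    rw [h1, ← Finset.sum_mul_sum]
    ring
  have hcard : ∑ _c : U → Fin N, P = μ := by
    simp [hμ]
  calc _ = (∑ c, ∑ c', expect D q (fun F => I c F * I c' F)) - μ ^ 2 := by
        rw [expect_congr fun F _ => hexp F, expect_add, expect_add, expect_mul_left, expect_const,
          expect_sum, expect_sum, Finset.sum_congr rfl fun c _ => hI c, hcard,
          Finset.sum_congr rfl fun c _ => expect_sum _ _]
        ring
    _ ≤ (∑ c : U → Fin N, ∑ c' : U → Fin N, (P ^ 2 + η * P ^ 2 *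
          (N : ℝ) ^ (Finset.univ.filter (fun u => c u = c' u)).card)) - μ ^ 2 :=
        sub_le_sub_right (Finset.sum_le_sum fun c _ => Finset.sum_le_sum fun c' _ => hle c c') _
    _ = η * P ^ 2 * ∑ c : U → Fin N, ∑ c' : U → Fin N,
          (N : ℝ) ^ (Finset.univ.filter (fun u => c u = c' u)).card := by
        simp only [Finset.sum_add_distrib, ← Finset.mul_sum]
        simp [hμ]
        ring
    _ ≤ η * P ^ 2 * (2 ^ Fintype.card U * ((N : ℝ) ^ Fintype.card U) ^ 2) :=
        mul_le_mul_of_nonneg_left (sum_pow_card_agree_le U N) (by positivity)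
    _ = _ := by
        rw [hμ]
        ring

theorem prob_forall_card_lt_le [dec : DecidableEq β] (hq : ∀ e, 0 < q e ∧ q e ≤ 1)
    {U : Type*} [Fintype U]
    [decU : DecidableEq U] {L N : ℕ}
    (S : Fin L → (U → Fin N) → Finset β) (hS : ∀ j c, S j c ⊆ D) {P η : ℝ}
    (hP : ∀ j c, ∏ e ∈ S j c, q e = P) (hη : 0 ≤ η)
    (h : ∀ j c c', Disjoint (S j c) (S j c') ∨ 1 ≤ η * (∏ e ∈ S j c ∩ S j c', q e) *
      (N : ℝ) ^ (Finset.univ.filter (fun u => c u = c' u)).card)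
    (hdis : ∀ i j c c', i ≠ j → Disjoint (S i c) (S j c'))
    (hμ : 0 < (N : ℝ) ^ Fintype.card U * P) :
    prob D q (fun F => ∀ j, ((Finset.univ.filter (fun c => S j c ⊆ F)).card : ℝ) <
      (N : ℝ) ^ Fintype.card U * P / 2) ≤ (4 * 2 ^ Fintype.card U * η) ^ L := by
  obtain rfl : dec = fun a b => Classical.propDecidable (a = b) := Subsingleton.elim _ _
  obtain rfl : decU = fun a b => Classical.propDecidable (a = b) := Subsingleton.elim _ _
  set μ := (N : ℝ) ^ Fintype.card U * P with hμdef
  let f : Fin L → Finset β → ℝ := fun j F =>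
    (4 / μ ^ 2) * (((Finset.univ.filter (fun c => S j c ⊆ F)).card : ℝ) - μ) ^ 2
  let R : Fin L → Finset β := fun j => Finset.univ.biUnion (S j)
  have hf : ∀ j F, f j (F ∩ R j) = f j F := by
    intro j F
    have h1 : (Finset.univ.filter (fun c => S j c ⊆ F ∩ R j)) =
        Finset.univ.filter (fun c => S j c ⊆ F) := by
      ext c
      simp only [Finset.mem_filter, Finset.mem_univ, true_and, Finset.subset_inter_iff]
      exact ⟨fun h => h.1, fun h => ⟨h, Finset.subset_biUnion_of_mem (S j) (Finset.mem_univ c)⟩⟩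
    simp only [f, h1]
  have hR : ∀ i ∈ (Finset.univ : Finset (Fin L)), ∀ j ∈ (Finset.univ : Finset (Fin L)),
      i ≠ j → Disjoint (R i) (R j) := by
    intro i _ j _ hij
    simp only [R, Finset.disjoint_biUnion_left, Finset.disjoint_biUnion_right]
    exact fun c _ c' _ => hdis i j _ _ hij
  have h0 : ∀ j F, 0 ≤ f j F := fun j F => by positivity
  calc _ ≤ expect D q (fun F => ∏ j, f j F) := by
        refine prob_le_expect (fun e => ⟨(hq e).1.le, (hq e).2⟩)
          (fun F _ => Finset.prod_nonneg fun j _ => h0 j F) fun F _ hF => ?_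
        refine Finset.one_le_prod fun j _ => ?_
        simp only [f]
        have h1 := hF j
        rw [div_mul_eq_mul_div, le_div_iff₀ (by positivity)]
        nlinarith
    _ = ∏ j, expect D q (f j) := expect_prod_of_local _ R f hR hf
    _ ≤ ∏ _j : Fin L, (4 * 2 ^ Fintype.card U * η) := by
        refine Finset.prod_le_prod (fun j _ => ?_) fun j _ => ?_
        · rw [← expect_const (D := D) (q := q) 0]
          exact expect_mono (fun e => ⟨(hq e).1.le, (hq e).2⟩) fun F _ => h0 j F
        · have h1 := expect_sq_sub_le hq (S j) (hS j) (hP j) hη (h j)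
          rw [expect_mul_left]
          refine (mul_le_mul_of_nonneg_left h1 (by positivity)).trans_eq ?_
          rw [← hμdef]
          field_simp
    _ = _ := by simp

end SecondMoment

section BadExtensions

variable {V : Type*} [DecidableEq V]

theorem predim_union_biUnion_le {α : Fin p → ℝ} (hα : ∀ i, 0 < α i)
    {F : Finset (Fin p × Finset V)} {X : Finset V} {l : ℕ} {θ : ℝ} (hX : ClosedUpTo α F l X)
    {κ : Type*} (J : Finset κ) (Z : κ → Finset V) (hXZ : ∀ j ∈ J, X ⊆ Z j)
    (hcard : ∀ j ∈ J, (Z j \ X).card ≤ l) (hZ : ∀ j ∈ J, predim α F (Z j) ≤ predim α F X + θ) :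
    predim α F (X ∪ J.biUnion Z) ≤ predim α F X + J.card * θ ∧
      ((X ∪ J.biUnion Z) \ X).card ≤ J.card * l := by
  induction J using Finset.induction_on with
  | empty => simp
  | insert i J hi ih =>
    obtain ⟨h1, h2⟩ := ih (fun j hj => hXZ j (Finset.mem_insert_of_mem hj))
      (fun j hj => hcard j (Finset.mem_insert_of_mem hj))
      (fun j hj => hZ j (Finset.mem_insert_of_mem hj))
    have hi' := Finset.mem_insert_self i J
    set W := X ∪ J.biUnion Z
    have hW : X ∪ (insert i J).biUnion Z = W ∪ Z i := by
      rw [Finset.biUnion_insert, Finset.union_comm (Z i), ← Finset.union_assoc]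
    rw [hW, Finset.card_insert_of_notMem hi]
    constructor
    · have h3 := predim_submodular hα F W (Z i)
      have h4 := hX (W ∩ Z i) (Finset.subset_inter Finset.subset_union_left (hXZ i hi'))
        ((Finset.card_le_card (Finset.sdiff_subset_sdiff Finset.inter_subset_right
          subset_rfl)).trans (hcard i hi'))
      have h5 := hZ i hi'
      push_cast
      linarith
    · rw [Finset.union_sdiff_distrib]
      have h3 := Finset.card_union_le (W \ X) (Z i \ X)
      have h4 := hcard i hi'
      linarith

/-- The maps whose image lies in an extension of `X` by at most `l` points with relative
predimension less than `d`. -/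
noncomputable def badMaps (α : Fin p → ℝ) {n : ℕ} (b l : ℕ) (d : ℝ) (X : Finset (Fin n))
    (F : Finset (Fin p × Finset (Fin n))) : Finset (Fin b → Fin n) :=
  Finset.univ.filter (fun y => ∃ Z : Finset (Fin n), X ⊆ Z ∧ (Z \ X).card ≤ l ∧
    (∀ u, y u ∈ Z) ∧ predim α F Z < predim α F X + d)

theorem card_badMaps_pow_le {α : Fin p → ℝ} (hα : ∀ i, 0 < α i) {n b b₀ l : ℕ} {d ε : ℝ}
    {X : Finset (Fin n)} {F : Finset (Fin p × Finset (Fin n))} (hb : X.card ≤ b₀)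
    (hX : ClosedUpTo α F l X)
    (hgap : ∀ {Z : Finset (Fin n)}, X ⊆ Z → (Z \ X).card ≤ l →
      predim α F Z < predim α F X + d → predim α F Z ≤ predim α F X + d - ε) (M : ℕ) :
    (badMaps α b l d X F).card ^ M ≤ ((b₀ + M * l) ^ b) ^ M *
      (Finset.univ.filter (fun W => (X ⊆ W ∧ (W \ X).card ≤ M * l) ∧
        predim α F W ≤ predim α F X + M * (d - ε))).card := by
  have hch : ∀ y : Fin b → Fin n, ∃ Z : Finset (Fin n), y ∈ badMaps α b l d X F →
      X ⊆ Z ∧ (Z \ X).card ≤ l ∧ (∀ u, y u ∈ Z) ∧ predim α F Z ≤ predim α F X + (d - ε) := by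
    intro y
    by_cases hy : y ∈ badMaps α b l d X F
    · obtain ⟨Z, h1, h2, h3, h4⟩ := (Finset.mem_filter.1 hy).2
      exact ⟨Z, fun _ => ⟨h1, h2, h3, by linarith [hgap h1 h2 h4]⟩⟩
    · exact ⟨∅, fun h => absurd h hy⟩
  choose Z hZ using hch
  let s := Fintype.piFinset (fun _ : Fin M => badMaps α b l d X F)
  let g : (Fin M → Fin b → Fin n) → Finset (Fin n) := fun ys =>
    X ∪ Finset.univ.biUnion (fun j => Z (ys j))
  have hs : ∀ ys ∈ s, ∀ j, ys j ∈ badMaps α b l d X F := fun ys h => Fintype.mem_piFinset.1 h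
  rw [← Fintype.card_piFinset_const]
  refine Finset.card_le_mul_card_image_of_maps_to (f := g) (fun ys hys => ?_) _ fun W hW => ?_
  · have h1 := predim_union_biUnion_le hα hX Finset.univ (fun j => Z (ys j))
      (fun j _ => (hZ _ (hs ys hys j)).1) (fun j _ => (hZ _ (hs ys hys j)).2.1)
      (fun j _ => (hZ _ (hs ys hys j)).2.2.2)
    simp only [Finset.card_univ, Fintype.card_fin] at h1
    exact Finset.mem_filter.2 ⟨Finset.mem_univ _, ⟨Finset.subset_union_left, h1.2⟩, h1.1⟩
  · obtain ⟨-, ⟨h1, h2⟩, -⟩ := Finset.mem_filter.1 hW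
    have hWc : W.card ≤ b₀ + M * l := by
      have := Finset.card_sdiff_add_card_eq_card h1
      omega
    calc _ ≤ (Fintype.piFinset (fun _ : Fin M => Fintype.piFinset (fun _ : Fin b => W))).card := by
          refine Finset.card_le_card fun ys hys => ?_
          obtain ⟨h3, h4⟩ := Finset.mem_filter.1 hys
          simp only [Fintype.mem_piFinset]
          intro j u
          rw [← h4]
          exact Finset.mem_union_right _ (Finset.mem_biUnion.2
            ⟨j, Finset.mem_univ _, (hZ _ (hs ys h3 j)).2.2.1 u⟩)
      _ = (W.card ^ b) ^ M := by simp
      _ ≤ _ := by gcongr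

theorem hprob_le_card_badMaps (k : Fin p → ℕ) {α γ : Fin p → ℝ} (hα : ∀ i, 0 < α i)
    (hγ : ∀ i, 0 < γ i ∧ γ i ≤ 1) (b b₀ l M : ℕ) :
    ∃ C : ℝ, 0 ≤ C ∧ ∀ (d ε : ℝ) (n : ℕ) (X : Finset (Fin n)) (μ : ℝ), 0 < n → X.card ≤ b₀ →
      0 < μ → (∀ (F : Finset (Fin p × Finset (Fin n))) {Z : Finset (Fin n)}, X ⊆ Z →
        (Z \ X).card ≤ l → predim α F Z < predim α F X + d →
          predim α F Z ≤ predim α F X + d - ε) →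
      hprob k α γ n (fun F => ClosedUpTo α F l X ∧ μ ≤ (badMaps α b l d X F).card) ≤
        C * (n : ℝ) ^ (M * (d - ε)) / μ ^ M := by
  refine ⟨(((b₀ + M * l : ℕ) : ℝ) ^ b) ^ M * (2 ^ (p * 2 ^ (b₀ + M * l)) * ((M * l : ℕ) + 1)),
    by positivity, fun d ε n X μ hn hX hμ hgap => ?_⟩
  set K : ℝ := (((b₀ + M * l : ℕ) : ℝ) ^ b) ^ M with hK
  set s := (Finset.univ : Finset (Finset (Fin n))).filter
    (fun W => X ⊆ W ∧ (W \ X).card ≤ M * l) with hs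
  let f : Finset (Fin n) → Finset (Fin p × Finset (Fin n)) → ℝ := fun W F =>
    if predim α F W ≤ predim α F X + M * (d - ε) then 1 else 0
  have hf0 : ∀ W F, 0 ≤ f W F := fun W F => by
    simp only [f]
    split_ifs <;> simp
  have h1 := sum_hprob_predim_le (k := k) hα hγ hn (l := M * l) hX (M * (d - ε))
  calc _ ≤ expect (potentialEdges k n) (edgeProb α γ n)
          (fun F => K / μ ^ M * ∑ W ∈ s, f W F) := by
        refine prob_le_expect (edgeProb_mem_Icc hα hγ hn)
          (fun F _ => mul_nonneg (by positivity) (Finset.sum_nonneg fun W _ => hf0 W F))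
          fun F _ hF => ?_
        have h2 := card_badMaps_pow_le (b := b) hα hX hF.1 (hgap F) M
        have h3 : μ ^ M ≤ ((badMaps α b l d X F).card : ℝ) ^ M := pow_le_pow_left₀ hμ.le hF.2 M
        have h4 : ((badMaps α b l d X F).card : ℝ) ^ M ≤ K * ∑ W ∈ s, f W F := by
          have h5 : ∑ W ∈ s, f W F = ((Finset.univ.filter (fun W =>
              (X ⊆ W ∧ (W \ X).card ≤ M * l) ∧
                predim α F W ≤ predim α F X + M * (d - ε))).card : ℝ) := by
            simp only [f, hs]
            rw [Finset.sum_boole, Finset.filter_filter]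
          rw [h5, hK]
          exact_mod_cast h2
        rw [div_mul_eq_mul_div, le_div_iff₀ (by positivity), one_mul]
        exact h3.trans h4
    _ = K / μ ^ M * ∑ W ∈ s, hprob k α γ n
          (fun F => predim α F W ≤ predim α F X + M * (d - ε)) := by
        rw [expect_mul_left, expect_sum]
        rfl
    _ ≤ K / μ ^ M * ((2 ^ (p * 2 ^ (b₀ + M * l)) * ((M * l : ℕ) + 1)) *
          (n : ℝ) ^ (M * (d - ε))) :=
        mul_le_mul_of_nonneg_left h1 (by positivity)
    _ = _ := by ring

end BadExtensions

theorem prod_le_prod_of_subset_of_le_one {β : Type*} {f : β → ℝ} {S T : Finset β} (h : S ⊆ T)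
    (hf : ∀ e, 0 ≤ f e ∧ f e ≤ 1) : ∏ e ∈ T, f e ≤ ∏ e ∈ S, f e := by
  rw [← Finset.prod_sdiff h]
  exact mul_le_of_le_one_left (Finset.prod_nonneg fun e _ => (hf e).1)
    (Finset.prod_le_one (fun e _ => (hf e).1) fun e _ => (hf e).2)

section Copies

variable {V W : Type*} [DecidableEq V]

/-- The image of a set of labelled edges under a map of the vertices. -/
def mapEdges (T : Finset (Fin p × Finset W)) (y : W → V) : Finset (Fin p × Finset V) :=
  T.image (fun e => (e.1, e.2.image y))

theorem injective_edge_image {y : W → V} (hy : Function.Injective y) :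
    Function.Injective (fun e : Fin p × Finset W => (e.1, e.2.image y)) := by
  rintro ⟨i, S⟩ ⟨j, T⟩ h
  simp only [Prod.mk.injEq] at h
  exact Prod.ext h.1 (Finset.image_injective hy h.2)

theorem edgeWeight_mapEdges (α : Fin p → ℝ) (T : Finset (Fin p × Finset W)) {y : W → V}
    (hy : Function.Injective y) : edgeWeight α (mapEdges T y) = edgeWeight α T :=
  Finset.sum_image (injective_edge_image hy).injOn

theorem prod_edgeProb_mapEdges {α γ : Fin p → ℝ} {n : ℕ} (hn : 0 < n)
    (T : Finset (Fin p × Finset W)) {y : W → Fin n} (hy : Function.Injective y) :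
    ∏ e ∈ mapEdges T y, edgeProb α γ n e =
      (∏ e ∈ T, γ e.1) * (n : ℝ) ^ (-edgeWeight α T) := by
  rw [prod_edgeProb hn, edgeWeight_mapEdges α T hy]
  congr 1
  exact Finset.prod_image (injective_edge_image hy).injOn

theorem mapEdges_subset_potentialEdges {k : Fin p → ℕ} {n : ℕ} {T : Finset (Fin p × Finset W)}
    (hT : ArityValid k T) {y : W → Fin n} (hy : Function.Injective y) :
    mapEdges T y ⊆ potentialEdges k n := by
  intro e he
  obtain ⟨f, hf, rfl⟩ := Finset.mem_image.1 he
  exact mem_potentialEdges.2 ((Finset.card_image_of_injective _ hy).trans (hT f hf))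

theorem extension_of_notMem_badMaps {α : Fin p → ℝ} (hα : ∀ i, 0 < α i) {b n t : ℕ}
    {E : Finset (Fin p × Finset (Fin b))} {F : Finset (Fin p × Finset (Fin n))}
    {A : Finset (Fin b)} {x y : Fin b → Fin n} (hx : Set.InjOn x A) (hE : PreservesEdges E F A x)
    (hy : Function.Injective y) (hyx : ∀ u ∈ A, y u = x u) (hEF : mapEdges E y ⊆ F)
    (hbad : y ∉ badMaps α b ((Finset.univ \ A).card + t)
      (predim α E Finset.univ - predim α E A) (A.image x) F) :
    PreservesEdges E F Finset.univ y ∧ ClosedUpTo α F t (Finset.univ.image y) := by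
  have hX := predim_image α hE hx
  have himg : A.image x ⊆ Finset.univ.image y := by
    intro v hv
    obtain ⟨u, hu, rfl⟩ := Finset.mem_image.1 hv
    exact Finset.mem_image.2 ⟨u, Finset.mem_univ _, hyx u hu⟩
  have hsd : (Finset.univ.image y \ A.image x).card ≤ (Finset.univ \ A).card := by
    refine (Finset.card_le_card (t := (Finset.univ \ A).image y) fun v hv => ?_).trans
      Finset.card_image_le
    obtain ⟨h1, h2⟩ := Finset.mem_sdiff.1 hv
    obtain ⟨u, -, rfl⟩ := Finset.mem_image.1 h1
    refine Finset.mem_image_of_mem y (Finset.mem_sdiff.2 ⟨Finset.mem_univ u, fun hu => h2 ?_⟩)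
    exact hyx u hu ▸ Finset.mem_image_of_mem x hu
  have hlow : ∀ Z : Finset (Fin n), Finset.univ.image y ⊆ Z →
      (Z \ Finset.univ.image y).card ≤ t → predim α E Finset.univ ≤ predim α F Z := by
    intro Z hZ hc
    by_contra hlt
    refine hbad (Finset.mem_filter.2 ⟨Finset.mem_univ _, Z, himg.trans hZ, ?_,
      fun u => hZ (Finset.mem_image_of_mem y (Finset.mem_univ u)), by rw [hX]; linarith⟩)
    have h1 : Z \ A.image x ⊆ (Z \ Finset.univ.image y) ∪ (Finset.univ.image y \ A.image x) := by
      intro v hv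
      simp only [Finset.mem_union, Finset.mem_sdiff] at hv ⊢
      by_cases h : v ∈ Finset.univ.image y
      · exact Or.inr ⟨h, hv.2⟩
      · exact Or.inl ⟨hv.1, h⟩
    have h2 := (Finset.card_le_card h1).trans (Finset.card_union_le _ _)
    omega
  have hpre : PreservesEdges E F Finset.univ y := by
    refine fun e _ => ⟨fun he => hEF (Finset.mem_image_of_mem _ he), fun he => ?_⟩
    by_contra hne
    have h1 := hlow _ subset_rfl (by simp)
    have hnm : (e.1, e.2.image y) ∉ mapEdges E y := fun h => by
      obtain ⟨f, hf, hfe⟩ := Finset.mem_image.1 h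
      exact hne (injective_edge_image hy hfe ▸ hf)
    have h2 : insert (e.1, e.2.image y) (mapEdges E y) ⊆ edgesIn F (Finset.univ.image y) := by
      intro f hf
      rcases Finset.mem_insert.1 hf with rfl | hf
      · exact mem_edgesIn.2 ⟨he, Finset.image_subset_image (Finset.subset_univ _)⟩
      · obtain ⟨g, -, rfl⟩ := Finset.mem_image.1 hf
        exact mem_edgesIn.2 ⟨hEF hf, Finset.image_subset_image (Finset.subset_univ _)⟩
    have h3 := edgeWeight_mono hα h2
    have h4 : edgeWeight α (insert (e.1, e.2.image y) (mapEdges E y)) =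
        α e.1 + edgeWeight α E := by
      rw [← edgeWeight_mapEdges α E hy]
      exact Finset.sum_insert hnm
    have h5 : edgesIn E Finset.univ = E := by
      ext
      simp [mem_edgesIn]
    unfold predim at h1
    rw [h5, Finset.card_image_of_injective _ hy] at h1
    linarith [hα e.1]
  refine ⟨hpre, fun Z hZ hc => ?_⟩
  rw [predim_image α hpre hy.injOn]
  exact hlow Z hZ hc

end Copies

section Pools

variable {b n N : ℕ} {A : Finset (Fin b)}

/-- The map agreeing with `x` on `A` and sending `u ∉ A` to the element with index `c u` of the
pool `ψ u`. -/
noncomputable def copyMap (A : Finset (Fin b)) (x : Fin b → Fin n)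
    (ψ : {u // u ∉ A} → Fin N → Fin n) (c : {u // u ∉ A} → Fin N) : Fin b → Fin n :=
  fun u => if h : u ∈ A then x u else ψ ⟨u, h⟩ (c ⟨u, h⟩)

theorem copyMap_of_mem {x : Fin b → Fin n} {ψ : {u // u ∉ A} → Fin N → Fin n}
    {c : {u // u ∉ A} → Fin N} {u : Fin b} (hu : u ∈ A) : copyMap A x ψ c u = x u :=
  dif_pos hu

theorem copyMap_of_notMem {x : Fin b → Fin n} {ψ : {u // u ∉ A} → Fin N → Fin n}
    {c : {u // u ∉ A} → Fin N} {u : Fin b} (hu : u ∉ A) :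
    copyMap A x ψ c u = ψ ⟨u, hu⟩ (c ⟨u, hu⟩) :=
  dif_neg hu

/-- The pools `ψ j u` are pairwise disjoint, injectively indexed and avoid `X`. -/
structure ArePools {L : ℕ} (A : Finset (Fin b)) (X : Finset (Fin n))
    (ψ : Fin L → {u // u ∉ A} → Fin N → Fin n) : Prop where
  inj : ∀ {i j u v s t}, ψ i u s = ψ j v t → i = j ∧ u = v ∧ s = t
  avoid : ∀ j u s, ψ j u s ∉ X

variable {L : ℕ} {x : Fin b → Fin n} {ψ : Fin L → {u // u ∉ A} → Fin N → Fin n}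

theorem ArePools.eq_of_copyMap_eq (h : ArePools A (A.image x) ψ) {i j : Fin L}
    {c c' : {u // u ∉ A} → Fin N} {u v : Fin b} (hu : u ∉ A)
    (huv : copyMap A x (ψ i) c u = copyMap A x (ψ j) c' v) :
    i = j ∧ u = v ∧ c ⟨u, hu⟩ = c' ⟨u, hu⟩ := by
  rw [copyMap_of_notMem hu] at huv
  by_cases hv : v ∈ A
  · rw [copyMap_of_mem hv] at huv
    exact absurd (huv ▸ Finset.mem_image_of_mem x hv) (h.avoid i ⟨u, hu⟩ (c ⟨u, hu⟩))
  · rw [copyMap_of_notMem hv] at huv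
    obtain ⟨h1, h2, h3⟩ := h.inj huv
    obtain rfl : u = v := congrArg Subtype.val h2
    exact ⟨h1, rfl, h3⟩

theorem ArePools.injective_copyMap (h : ArePools A (A.image x) ψ) (hx : Set.InjOn x A)
    (j : Fin L) (c : {u // u ∉ A} → Fin N) : Function.Injective (copyMap A x (ψ j) c) := by
  intro u v huv
  by_cases hu : u ∈ A
  · by_cases hv : v ∈ A
    · rw [copyMap_of_mem hu, copyMap_of_mem hv] at huv
      exact hx hu hv huv
    · exact (h.eq_of_copyMap_eq hv huv.symm).2.1.symm
  · exact (h.eq_of_copyMap_eq hu huv).2.1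

theorem ArePools.copyMap_injective (h : ArePools A (A.image x) ψ) (j : Fin L) :
    Function.Injective (copyMap A x (ψ j)) := by
  intro c c' hc
  funext u
  exact (h.eq_of_copyMap_eq u.2 (congrFun hc u.1)).2.2

theorem ArePools.exists_of_mem_inter (h : ArePools A (A.image x) ψ) {i j : Fin L}
    {c c' : {u // u ∉ A} → Fin N} {R : Finset (Fin p × Finset (Fin b))}
    {e : Fin p × Finset (Fin n)}
    (he : e ∈ mapEdges R (copyMap A x (ψ i) c) ∩ mapEdges R (copyMap A x (ψ j) c')) :
    ∃ f ∈ R, (f.1, f.2.image (copyMap A x (ψ i) c)) = e ∧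
      ∀ u ∈ f.2, ∀ hu : u ∉ A, i = j ∧ c ⟨u, hu⟩ = c' ⟨u, hu⟩ := by
  obtain ⟨h1, h2⟩ := Finset.mem_inter.1 he
  obtain ⟨f, hf, rfl⟩ := Finset.mem_image.1 h1
  obtain ⟨g, -, hgf⟩ := Finset.mem_image.1 h2
  refine ⟨f, hf, rfl, fun u hu huA => ?_⟩
  have h3 : copyMap A x (ψ i) c u ∈ g.2.image (copyMap A x (ψ j) c') := by
    rw [(Prod.mk.inj hgf).2]
    exact Finset.mem_image_of_mem _ hu
  obtain ⟨v, -, hv⟩ := Finset.mem_image.1 h3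
  have h4 := h.eq_of_copyMap_eq huA hv.symm
  exact ⟨h4.1, h4.2.2⟩

theorem exists_arePools (A : Finset (Fin b)) (x : Fin b → Fin n) (L : ℕ)
    (hn : L * b + b + 1 ≤ n) :
    ∃ ψ : Fin L → {u // u ∉ A} → Fin (n / (L * b + b + 1)) → Fin n,
      ArePools A (A.image x) ψ := by
  set K := L * b + b + 1
  have h1 : K * (n / K) ≤ n := Nat.mul_div_le n K
  have h2 : 1 ≤ n / K := (Nat.one_le_div_iff (by omega)).2 hn
  have hA : Fintype.card {u // u ∉ A} ≤ b := by
    simp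
  have hX : (A.image x).card ≤ b :=
    Finset.card_image_le.trans (by simpa using Finset.card_le_univ A)
  have h3 : Fintype.card (Fin L × {u // u ∉ A} × Fin (n / K)) ≤
      Fintype.card {v : Fin n // v ∉ A.image x} := by
    have h4 : Fintype.card {v : Fin n // v ∉ A.image x} = n - (A.image x).card := by
      rw [Fintype.card_subtype_compl, Fintype.card_fin, Fintype.card_coe]
    rw [h4, Fintype.card_prod, Fintype.card_prod, Fintype.card_fin, Fintype.card_fin]
    have h5 : L * (Fintype.card {u // u ∉ A} * (n / K)) ≤ L * (b * (n / K)) := by gcongr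
    have h6 : L * (b * (n / K)) + b ≤ K * (n / K) := by
      calc _ ≤ L * (b * (n / K)) + (b * (n / K) + n / K) := by nlinarith
        _ = K * (n / K) := by ring
    omega
  obtain ⟨g⟩ := Function.Embedding.nonempty_of_card_le h3
  refine ⟨fun j u s => (g (j, u, s)).1, ⟨fun {i j u v s t} h => ?_, fun j u s => (g _).2⟩⟩
  have h4 := g.injective (Subtype.ext h)
  simp only [Prod.mk.injEq] at h4
  exact h4

theorem hprob_few_copies_le {k : Fin p → ℕ} {α γ : Fin p → ℝ} (hα : ∀ i, 0 < α i)
    (hγ : ∀ i, 0 < γ i ∧ γ i ≤ 1) (hn : 0 < n) {E : Finset (Fin p × Finset (Fin b))}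
    (hE : ArityValid k E) {ε : ℝ}
    (hε : ∀ S, A ⊂ S → predim α E A + ε ≤ predim α E S) (hx : Set.InjOn x A)
    (hψ : ArePools A (A.image x) ψ) {K : ℝ} (hK : 1 ≤ K) (hN : (n : ℝ) ≤ K * N)
    {R : Finset (Fin p × Finset (Fin b))} (hR : R = E.filter (fun e => ¬ e.2 ⊆ A)) :
    hprob k α γ n (fun F => ∀ j,
      ((Finset.univ.filter (fun c => mapEdges R (copyMap A x (ψ j) c) ⊆ F)).card : ℝ) <
        (N : ℝ) ^ Fintype.card {u // u ∉ A} *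
          ((∏ e ∈ R, γ e.1) * (n : ℝ) ^ (-edgeWeight α R)) / 2) ≤
      (4 * 2 ^ Fintype.card {u // u ∉ A} * (K ^ b / (∏ e ∈ R, γ e.1) * (n : ℝ) ^ (-ε))) ^ L := by
  have hn' : (0 : ℝ) < n := by exact_mod_cast hn
  have hγR : 0 < ∏ e ∈ R, γ e.1 := Finset.prod_pos fun e _ => (hγ e.1).1
  have hN0 : (0 : ℝ) < N := pos_of_mul_pos_right (hn'.trans_le hN) (by linarith)
  have hRE : R ⊆ E := hR ▸ Finset.filter_subset _ _
  have hq : ∀ e, 0 < edgeProb α γ n e ∧ edgeProb α γ n e ≤ 1 := edgeProb_mem hα hγ hn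
  refine prob_forall_card_lt_le hq (fun j c => mapEdges R (copyMap A x (ψ j) c)) ?_ ?_
    (by positivity) ?_ ?_ (by positivity)
  · exact fun j c => mapEdges_subset_potentialEdges (fun e he => hE e (hRE he))
      (hψ.injective_copyMap hx j c)
  · exact fun j c => prod_edgeProb_mapEdges hn R (hψ.injective_copyMap hx j c)
  · intro j c c'
    by_cases hdis : Disjoint (mapEdges R (copyMap A x (ψ j) c)) (mapEdges R (copyMap A x (ψ j) c'))
    · exact Or.inl hdis
    right
    set I := mapEdges R (copyMap A x (ψ j) c) ∩ mapEdges R (copyMap A x (ψ j) c') with hI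
    set G := Finset.univ.filter (fun u => c u = c' u) with hG
    let S : Finset (Fin b) := A ∪ G.image Subtype.val
    have hAS : A ⊆ S := Finset.subset_union_left
    let RS := R.filter (fun e => e.2 ⊆ S)
    have hIS : I ⊆ mapEdges RS (copyMap A x (ψ j) c) := by
      intro e he
      obtain ⟨f, hf, rfl, hfu⟩ := hψ.exists_of_mem_inter he
      refine Finset.mem_image_of_mem _ (Finset.mem_filter.2 ⟨hf, fun u hu => ?_⟩)
      by_cases huA : u ∈ A
      · exact hAS huA
      · exact Finset.mem_union_right _ (Finset.mem_image.2
          ⟨⟨u, huA⟩, Finset.mem_filter.2 ⟨Finset.mem_univ _, (hfu u hu huA).2⟩, rfl⟩)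
    have hSA : (S \ A).card = G.card := by
      have h1 : S \ A = G.image Subtype.val := by
        refine Finset.union_sdiff_cancel_left (Finset.disjoint_left.2 fun u hu hu' => ?_)
        obtain ⟨v, -, rfl⟩ := Finset.mem_image.1 hu'
        exact v.2 hu
      rw [h1, Finset.card_image_of_injective _ Subtype.val_injective]
    have hne : A ⊂ S := by
      refine hAS.ssubset_of_ne fun hEq => ?_
      obtain ⟨e, he⟩ := Finset.nonempty_iff_ne_empty.2
        (fun h => hdis (Finset.disjoint_iff_inter_eq_empty.2 h))
      obtain ⟨f, hf, -⟩ := Finset.mem_image.1 (hIS he)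
      obtain ⟨h1, h2⟩ := Finset.mem_filter.1 hf
      rw [← hEq] at h2
      rw [hR] at h1
      exact (Finset.mem_filter.1 h1).2 h2
    have hRS : edgesIn E S \ edgesIn E A = RS := by
      ext e
      simp only [Finset.mem_sdiff, mem_edgesIn, RS, hR, Finset.mem_filter]
      tauto
    have hw := predim_sub α E hAS
    rw [hRS, hSA] at hw
    have hw' : edgeWeight α RS ≤ (G.card : ℝ) - ε := by linarith [hε S hne]
    have hGb : G.card ≤ b := by
      rw [← hSA]
      simpa using Finset.card_le_univ (S \ A)
    have h1 : (∏ e ∈ R, γ e.1) * (n : ℝ) ^ (-edgeWeight α RS) ≤ ∏ e ∈ I, edgeProb α γ n e := by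
      calc _ ≤ (∏ e ∈ RS, γ e.1) * (n : ℝ) ^ (-edgeWeight α RS) := by
            refine mul_le_mul_of_nonneg_right ?_ (Real.rpow_nonneg hn'.le _)
            exact prod_le_prod_of_subset_of_le_one (Finset.filter_subset _ R)
              fun e => ⟨(hγ e.1).1.le, (hγ e.1).2⟩
        _ = ∏ e ∈ mapEdges RS (copyMap A x (ψ j) c), edgeProb α γ n e :=
            (prod_edgeProb_mapEdges hn RS (hψ.injective_copyMap hx j c)).symm
        _ ≤ _ := by
            exact prod_le_prod_of_subset_of_le_one hIS fun e => ⟨(hq e).1.le, (hq e).2⟩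
    have h2 : (n : ℝ) ^ (-(G.card : ℝ) + ε) ≤ (n : ℝ) ^ (-edgeWeight α RS) :=
      Real.rpow_le_rpow_of_exponent_le (by exact_mod_cast hn) (by linarith)
    have h3 : (n : ℝ) ^ G.card ≤ K ^ b * (N : ℝ) ^ G.card :=
      calc (n : ℝ) ^ G.card ≤ (K * N) ^ G.card := by gcongr
        _ = K ^ G.card * (N : ℝ) ^ G.card := mul_pow _ _ _
        _ ≤ _ := by gcongr
    have h4 : (n : ℝ) ^ (-ε) * (n : ℝ) ^ (-(G.card : ℝ) + ε) * (n : ℝ) ^ G.card = 1 := by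
      rw [← Real.rpow_natCast, ← Real.rpow_add hn', ← Real.rpow_add hn',
        ← Real.rpow_zero (n : ℝ)]
      congr 1
      ring
    calc (1 : ℝ) = (n : ℝ) ^ (-ε) * (n : ℝ) ^ (-(G.card : ℝ) + ε) * (n : ℝ) ^ G.card := h4.symm
      _ ≤ (n : ℝ) ^ (-ε) * (n : ℝ) ^ (-edgeWeight α RS) * (K ^ b * (N : ℝ) ^ G.card) := by
          gcongr
      _ = (K ^ b / (∏ e ∈ R, γ e.1) * (n : ℝ) ^ (-ε)) *
            ((∏ e ∈ R, γ e.1) * (n : ℝ) ^ (-edgeWeight α RS)) * (N : ℝ) ^ G.card := by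
          field_simp
      _ ≤ _ := by gcongr
  · intro i j c c' hij
    rw [Finset.disjoint_iff_inter_eq_empty, Finset.eq_empty_iff_forall_notMem]
    intro e he
    obtain ⟨f, hf, -, hfu⟩ := hψ.exists_of_mem_inter he
    rw [hR] at hf
    obtain ⟨u, hu, huA⟩ := Finset.not_subset.1 (Finset.mem_filter.1 hf).2
    exact hij (hfu u hu huA).1

end Pools

section ExtensionProperty

variable {b n N L : ℕ} {A : Finset (Fin b)} {E : Finset (Fin p × Finset (Fin b))}
  {α γ : Fin p → ℝ}

theorem ArePools.exists_extension (hα : ∀ i, 0 < α i) {t : ℕ}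
    {F : Finset (Fin p × Finset (Fin n))} {x : Fin b → Fin n}
    {ψ : Fin L → {u // u ∉ A} → Fin N → Fin n} (hψ : ArePools A (A.image x) ψ)
    (hx : Set.InjOn x A) (hE : PreservesEdges E F A x) {R : Finset (Fin p × Finset (Fin b))}
    (hR : R = E.filter (fun e => ¬ e.2 ⊆ A)) (j : Fin L)
    (hj : (badMaps α b ((Finset.univ \ A).card + t)
      (predim α E Finset.univ - predim α E A) (A.image x) F).card <
        (Finset.univ.filter (fun c => mapEdges R (copyMap A x (ψ j) c) ⊆ F)).card) :
    ∃ y : Fin b → Fin n, Function.Injective y ∧ (∀ u ∈ A, y u = x u) ∧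
      PreservesEdges E F Finset.univ y ∧ ClosedUpTo α F t (Finset.univ.image y) := by
  rw [← Finset.card_image_of_injective _ (hψ.copyMap_injective j)] at hj
  obtain ⟨y, hy, hbad⟩ := Finset.exists_mem_notMem_of_card_lt_card hj
  obtain ⟨c, hc, rfl⟩ := Finset.mem_image.1 hy
  have hRF := (Finset.mem_filter.1 hc).2
  have hinj := hψ.injective_copyMap hx j c
  have hyx : ∀ u ∈ A, copyMap A x (ψ j) c u = x u := fun u hu => copyMap_of_mem hu
  refine ⟨_, hinj, hyx, extension_of_notMem_badMaps hα hx hE hinj hyx (fun e he => ?_) hbad⟩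
  obtain ⟨f, hf, rfl⟩ := Finset.mem_image.1 he
  by_cases hfA : f.2 ⊆ A
  · have h1 : f.2.image (copyMap A x (ψ j) c) = f.2.image x :=
      Finset.image_congr fun u hu => hyx u (hfA hu)
    rw [h1]
    exact (hE f hfA).1 hf
  · exact hRF (Finset.mem_image_of_mem _ (hR ▸ Finset.mem_filter.2 ⟨hf, hfA⟩))

theorem Safe.exists_gap (hirr : IrrHyp α) (hA : Safe α E A) :
    ∃ ε : ℝ, 0 < ε ∧ ∀ S, A ⊂ S → predim α E A + ε ≤ predim α E S := by
  obtain ⟨ε, hε, h⟩ := exists_pos_forall_le (Finset.univ.filter (fun S => A ⊂ S))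
    (fun S => predim α E S - predim α E A) fun S hS => by
      have hS := (Finset.mem_filter.1 hS).2
      exact sub_pos.2 (lt_of_le_of_ne (hA S hS.1) (predim_ne_of_ssubset hirr E hS).symm)
  exact ⟨ε, hε, fun S hS => by
    linarith [h S (Finset.mem_filter.2 ⟨Finset.mem_univ _, hS⟩)]⟩

theorem rpow_neg_pow_le {ε c : ℝ} {m : ℕ} (hn : 0 < n) (h : c ≤ m * ε) :
    ((n : ℝ) ^ (-ε)) ^ m ≤ (n : ℝ) ^ (-c) := by
  rw [← Real.rpow_natCast, ← Real.rpow_mul (Nat.cast_nonneg n)]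
  exact Real.rpow_le_rpow_of_exponent_le (by exact_mod_cast hn) (by linarith)

theorem exists_hprob_extension_failure_le {k : Fin p → ℕ} (hα : ∀ i, 0 < α i)
    (hγ : ∀ i, 0 < γ i ∧ γ i ≤ 1) (hirr : IrrHyp α) (hE : ArityValid k E) (hA : Safe α E A)
    (t : ℕ) :
    ∃ (C : ℝ) (n₀ : ℕ), 0 ≤ C ∧ ∀ n, n₀ < n → ∀ x : Fin b → Fin n,
      hprob k α γ n (fun F => (Set.InjOn x A ∧ PreservesEdges E F A x ∧
        ClosedUpTo α F ((Finset.univ \ A).card + t) (A.image x)) ∧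
        ¬ ∃ y : Fin b → Fin n, Function.Injective y ∧ (∀ u ∈ A, y u = x u) ∧
          PreservesEdges E F Finset.univ y ∧ ClosedUpTo α F t (Finset.univ.image y)) ≤
        C * (n : ℝ) ^ (-((b : ℝ) + 1)) := by
  obtain ⟨ε₁, hε₁, hgap₁⟩ := hA.exists_gap hirr
  set l := (Finset.univ \ A).card + t with hl
  set d := predim α E Finset.univ - predim α E A with hd
  obtain ⟨ε₂, hε₂, hgap₂⟩ := exists_predim_gap hα d l
  obtain ⟨L, hL⟩ := exists_nat_ge (((b : ℝ) + 1) / ε₁)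
  obtain ⟨M, hM⟩ := exists_nat_ge (((b : ℝ) + 1) / ε₂)
  rw [div_le_iff₀ hε₁] at hL
  rw [div_le_iff₀ hε₂] at hM
  obtain ⟨C, hC, hbad⟩ := hprob_le_card_badMaps k hα hγ b b l M
  set K := L * b + b + 1 with hK
  set R := E.filter (fun e => ¬ e.2 ⊆ A) with hR
  set Γ := ∏ e ∈ R, γ e.1 with hΓ
  have hΓ0 : 0 < Γ := Finset.prod_pos fun e _ => (hγ e.1).1
  set m := Fintype.card {u // u ∉ A} with hm
  have hmA : m = (Finset.univ \ A).card := by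
    rw [hm, Fintype.card_subtype_compl, Finset.card_sdiff_of_subset (Finset.subset_univ A)]
    simp
  have hmb : m ≤ b := by
    rw [hmA]
    simpa using Finset.card_le_univ (Finset.univ \ A)
  have hdR : d = m - edgeWeight α R := by
    rw [hd, predim_sub α E (Finset.subset_univ A), hmA]
    congr 2
    ext e
    simp only [Finset.mem_sdiff, mem_edgesIn, hR, Finset.mem_filter]
    simp
    tauto
  set B : ℝ := (2 * K) ^ b with hB
  have hK1 : (1 : ℝ) ≤ 2 * K := by
    have : (1 : ℝ) ≤ K := by
      rw [hK]
      push_cast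
      nlinarith [Nat.cast_nonneg (α := ℝ) b, mul_nonneg (Nat.cast_nonneg (α := ℝ) L)
        (Nat.cast_nonneg (α := ℝ) b)]
    linarith
  have hB0 : 0 < B := by positivity
  set κ := Γ / (2 * B) with hκ
  have hκ0 : 0 < κ := by positivity
  refine ⟨(4 * 2 ^ m * (B / Γ)) ^ L + C / κ ^ M, K, by positivity, fun n hn x => ?_⟩
  have hn0 : 0 < n := by omega
  have hn' : (0 : ℝ) < n := by exact_mod_cast hn0
  by_cases hx : Set.InjOn x A
  swap
  · refine le_trans (prob_mono (Q := fun _ => False) (edgeProb_mem_Icc hα hγ hn0)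
      fun F _ h => hx h.1.1) ?_
    refine le_trans (le_of_eq ?_) (by positivity : (0 : ℝ) ≤ _)
    simp [prob, expect_const]
  obtain ⟨ψ, hψ⟩ := exists_arePools A x L hn.le
  set N := n / K with hN
  have hnN : (n : ℝ) ≤ 2 * K * N := by
    have h1 : n < K * (N + 1) := Nat.lt_mul_div_succ n (by omega)
    have h2 : 1 ≤ N := (Nat.one_le_div_iff (by omega)).2 hn.le
    have h3 : n ≤ 2 * K * N := by nlinarith
    exact_mod_cast h3
  set μ := (N : ℝ) ^ m * (Γ * (n : ℝ) ^ (-edgeWeight α R)) with hμ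
  have hμκ : κ * (n : ℝ) ^ d ≤ μ / 2 := by
    have h1 : (n : ℝ) ^ m ≤ B * (N : ℝ) ^ m :=
      calc (n : ℝ) ^ m ≤ (2 * K * N) ^ m := by gcongr
        _ = (2 * K) ^ m * (N : ℝ) ^ m := mul_pow _ _ _
        _ ≤ _ := by
          rw [hB]
          gcongr
    have h2 : (n : ℝ) ^ d = (n : ℝ) ^ m * (n : ℝ) ^ (-edgeWeight α R) := by
      rw [hdR, sub_eq_add_neg, Real.rpow_add hn', Real.rpow_natCast]
    rw [h2, hκ, hμ]
    calc Γ / (2 * B) * ((n : ℝ) ^ m * (n : ℝ) ^ (-edgeWeight α R))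
        ≤ Γ / (2 * B) * (B * (N : ℝ) ^ m * (n : ℝ) ^ (-edgeWeight α R)) := by gcongr
      _ = _ := by field_simp
  have hμ0 : 0 < μ / 2 := lt_of_lt_of_le (by positivity) hμκ
  have hX : (A.image x).card ≤ b :=
    Finset.card_image_le.trans (by simpa using Finset.card_le_univ A)
  have hfew := hprob_few_copies_le hα hγ hn0 hE hgap₁ hx hψ hK1 hnN hR
  have hmany := hbad d ε₂ n (A.image x) (μ / 2) hn0 hX hμ0 fun F _ h1 h2 h3 => hgap₂ F h1 h2 h3
  refine (prob_le_add (edgeProb_mem_Icc hα hγ hn0) fun F _ h => ?_).trans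
    ((add_le_add hfew hmany).trans ?_)
  · obtain ⟨⟨-, hpre, hcl⟩, hno⟩ := h
    by_contra hcon
    rw [not_or, not_forall] at hcon
    obtain ⟨⟨j, hj⟩, hb⟩ := hcon
    refine hno (hψ.exists_extension hα hx hpre hR j ?_)
    have h1 := lt_of_not_ge fun h => hb ⟨hcl, h⟩
    exact_mod_cast h1.trans_le (not_lt.1 hj)
  · rw [add_mul]
    refine add_le_add ?_ ?_
    · rw [← mul_assoc, mul_pow]
      exact mul_le_mul_of_nonneg_left (rpow_neg_pow_le hn0 hL) (by positivity)
    · calc C * (n : ℝ) ^ (M * (d - ε₂)) / (μ / 2) ^ M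
          ≤ C * (n : ℝ) ^ (M * (d - ε₂)) / (κ * (n : ℝ) ^ d) ^ M := by gcongr
        _ = C / κ ^ M * ((n : ℝ) ^ (-ε₂)) ^ M := by
          have h1 : (n : ℝ) ^ (M * (d - ε₂)) = ((n : ℝ) ^ d) ^ M * ((n : ℝ) ^ (-ε₂)) ^ M := by
            rw [← mul_pow, ← Real.rpow_add hn', ← Real.rpow_natCast, ← Real.rpow_mul hn'.le]
            congr 1
            ring
          rw [h1, mul_pow]
          field_simp
        _ ≤ _ := mul_le_mul_of_nonneg_left (rpow_neg_pow_le hn0 hM) (by positivity)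

theorem tendsto_hprob_not_extensionProperty {k : Fin p → ℕ} (hα : ∀ i, 0 < α i)
    (hγ : ∀ i, 0 < γ i ∧ γ i ≤ 1) (hirr : IrrHyp α) (hE : ArityValid k E) (hA : Safe α E A)
    (t : ℕ) :
    Tendsto (fun n => hprob k α γ n (fun F => ¬ ExtensionProperty α E A t F)) atTop (𝓝 0) := by
  obtain ⟨C, n₀, hC, h⟩ := exists_hprob_extension_failure_le hα hγ hirr hE hA t
  have h1 : ∀ n, n₀ < n → hprob k α γ n (fun F => ¬ ExtensionProperty α E A t F) ≤
      C * (n : ℝ) ^ (-(1 : ℝ)) := by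
    intro n hn
    have hn0 : 0 < n := by omega
    have hn' : (0 : ℝ) < n := by exact_mod_cast hn0
    refine (prob_le_sum (edgeProb_mem_Icc hα hγ hn0) (Finset.univ : Finset (Fin b → Fin n)) _
      fun F _ hF => ?_).trans ((Finset.sum_le_sum fun x _ => h n hn x).trans_eq ?_)
    · unfold ExtensionProperty at hF
      push Not at hF
      obtain ⟨x, h1, h2, h3, h4⟩ := hF
      refine ⟨x, Finset.mem_univ x, ⟨h1, h2, h3⟩, ?_⟩
      push Not
      exact h4
    · have h2 : (n : ℝ) ^ b * (n : ℝ) ^ (-((b : ℝ) + 1)) = (n : ℝ) ^ (-(1 : ℝ)) := by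
        rw [← Real.rpow_natCast, ← Real.rpow_add hn']
        congr 1
        ring
      simp only [Finset.sum_const, Finset.card_univ, Fintype.card_fun, Fintype.card_fin,
        nsmul_eq_mul, Nat.cast_pow]
      rw [← h2]
      ring
  refine squeeze_zero' ?_ ((eventually_gt_atTop n₀).mono h1) ?_
  · exact (eventually_gt_atTop 0).mono fun n hn => prob_nonneg (edgeProb_mem_Icc hα hγ hn) _
  · simpa using ((tendsto_rpow_neg_atTop one_pos).comp tendsto_natCast_atTop_atTop).const_mul C

theorem tendsto_hprob_typical (k : Fin p → ℕ) (hα : ∀ i, 0 < α i)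
    (hγ : ∀ i, 0 < γ i ∧ γ i ≤ 1) (hirr : IrrHyp α) (Q : ℕ) :
    Tendsto (fun n => hprob k α γ n (fun F => Typical k α Q F)) atTop (𝓝 1) := by
  let T := (b : Fin (Q + 1)) × (t : Fin (Q + 1)) × Finset (Fin p × Finset (Fin b)) ×
    Finset (Fin b)
  let bad : T → ∀ n, Finset (Fin p × Finset (Fin n)) → Prop := fun x _ F =>
    (ArityValid k x.2.2.1 ∧ Safe α x.2.2.1 x.2.2.2) ∧
      ¬ ExtensionProperty α x.2.2.1 x.2.2.2 x.2.1 F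
  have hbad : ∀ x : T, Tendsto (fun n => hprob k α γ n (bad x n)) atTop (𝓝 0) := by
    intro x
    by_cases h : ArityValid k x.2.2.1 ∧ Safe α x.2.2.1 x.2.2.2
    · simpa only [bad, h, true_and] using
        tendsto_hprob_not_extensionProperty hα hγ hirr h.1 h.2 x.2.1
    · simp only [bad, h, false_and, hprob, prob, if_false, expect_const]
      exact tendsto_const_nhds
  have hsum := (tendsto_hprob_exists_predim_neg k hα hγ Q).add
    (tendsto_finsetSum Finset.univ fun x _ => hbad x)
  simp only [Finset.sum_const_zero, add_zero] at hsum
  have h1 : ∀ n, 0 < n → 1 - hprob k α γ n (fun F => Typical k α Q F) ≤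
      hprob k α γ n (fun F => ∃ X : Finset (Fin n), X.card ≤ Q ∧ predim α F X < 0) +
        ∑ x : T, hprob k α γ n (bad x n) := by
    intro n hn
    have hq := edgeProb_mem_Icc hα hγ hn
    rw [hprob, ← prob_not]
    refine (prob_le_add hq (R := fun F => ∃ x : T, bad x n F) fun F hF h => ?_).trans
      (add_le_add_right (prob_le_sum hq _ _ fun F _ ⟨x, hx⟩ => ⟨x, Finset.mem_univ x, hx⟩) _)
    by_contra hcon
    push Not at hcon
    refine h ⟨hn, arityValid_iff.2 hF, fun X hX => hcon.1 X hX, fun b t hb ht E A hE hA => ?_⟩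
    by_contra hno
    exact hcon.2 ⟨⟨b, by omega⟩, ⟨t, by omega⟩, E, A⟩ ⟨⟨hE, hA⟩, hno⟩
  have h2 : Tendsto (fun n => 1 - hprob k α γ n (fun F => Typical k α Q F)) atTop (𝓝 0) := by
    refine squeeze_zero' ((eventually_gt_atTop 0).mono fun n hn => ?_)
      ((eventually_gt_atTop 0).mono h1) hsum
    rw [hprob, ← prob_not]
    exact prob_nonneg (edgeProb_mem_Icc hα hγ hn) _
  simpa using h2.const_sub 1

end ExtensionProperty

section ZeroOneLaw

variable {k : Fin p → ℕ} {α γ : Fin p → ℝ}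

theorem Pn_eq_hprob (k : Fin p → ℕ) (α γ : Fin p → ℝ) (n : ℕ) (φ : (Lang p k).Sentence) :
    Pn k α γ n φ = hprob k α γ n (fun F => RealizeS k (Fin n) (structOf k n (configOf F)) φ) :=
  Pev_eq_hprob k α γ n fun E => RealizeS k (Fin n) (structOf k n E) φ

theorem Pn_not (k : Fin p → ℕ) (α γ : Fin p → ℝ) (n : ℕ) (φ : (Lang p k).Sentence) :
    Pn k α γ n (Language.BoundedFormula.not φ) = 1 - Pn k α γ n φ := by
  rw [Pn_eq_hprob, Pn_eq_hprob]
  exact prob_not _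

theorem mem_Talpha_of_typical (hα : ∀ i, 0 < α i) (hγ : ∀ i, 0 < γ i ∧ γ i ≤ 1) (hirr : IrrHyp α)
    {Q : ℕ} {φ : (Lang p k).Sentence}
    (h : ∀ n (E : Config p n), Typical k α Q E.edges → RealizeS k (Fin n) (structOf k n E) φ) :
    φ ∈ Talpha k α γ := by
  refine tendsto_of_tendsto_of_tendsto_of_le_of_le' (tendsto_hprob_typical k hα hγ hirr Q)
    tendsto_const_nhds ?_ ?_
  · filter_upwards [eventually_gt_atTop 0] with n hn
    rw [Pn_eq_hprob]
    refine prob_mono (edgeProb_mem_Icc hα hγ hn) fun F _ hF => h n _ ?_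
    rwa [edges_configOf]
  · filter_upwards [eventually_gt_atTop 0] with n hn
    have h1 : 0 ≤ Pn k α γ n (Language.BoundedFormula.not φ) := by
      rw [Pn_eq_hprob]
      exact prob_nonneg (edgeProb_mem_Icc hα hγ hn) _
    rw [Pn_not] at h1
    linarith

theorem mem_or_not_mem_Talpha (hα : ∀ i, 0 < α i) (hγ : ∀ i, 0 < γ i ∧ γ i ≤ 1)
    (hirr : IrrHyp α) (φ : (Lang p k).Sentence) :
    φ ∈ Talpha k α γ ∨ Language.BoundedFormula.not φ ∈ Talpha k α γ := by
  obtain ⟨Q, hQ⟩ := exists_typical_realize_iff k hα φ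
  by_cases h : ∃ m, ∃ E : Config p m, Typical k α Q E.edges ∧
      RealizeS k (Fin m) (structOf k m E) φ
  · obtain ⟨m, E', hE', hφ⟩ := h
    exact .inl <| mem_Talpha_of_typical hα hγ hirr fun n E hE => (hQ n m E E' hE hE').2 hφ
  · exact .inr <| mem_Talpha_of_typical hα hγ hirr fun n E hE hφ => h ⟨n, E, hE, hφ⟩

theorem not_mem_Talpha_of_mem {φ : (Lang p k).Sentence} (h : φ ∈ Talpha k α γ) :
    Language.BoundedFormula.not φ ∉ Talpha k α γ := fun h' => by
  have h1 : Tendsto (fun n => Pn k α γ n (Language.BoundedFormula.not φ)) atTop (𝓝 (1 - 1)) := by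
    simp only [Pn_not]
    exact tendsto_const_nhds.sub h
  exact absurd (tendsto_nhds_unique h1 h') (by norm_num)

theorem isSatisfiable_Talpha (hα : ∀ i, 0 < α i) (hγ : ∀ i, 0 < γ i ∧ γ i ≤ 1) :
    (Talpha k α γ).IsSatisfiable := by
  rw [Language.Theory.isSatisfiable_iff_isFinitelySatisfiable]
  intro T₀ hT₀
  have hlim : Tendsto (fun n => ∑ φ ∈ T₀, Pn k α γ n (Language.BoundedFormula.not φ)) atTop
      (𝓝 (∑ _φ ∈ T₀, (1 - 1 : ℝ))) := by
    refine tendsto_finsetSum _ fun φ hφ => ?_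
    simp only [Pn_not]
    exact tendsto_const_nhds.sub (hT₀ hφ)
  simp only [sub_self, Finset.sum_const_zero] at hlim
  obtain ⟨n, hn1, hn⟩ :=
    ((hlim.eventually (gt_mem_nhds one_pos)).and (eventually_gt_atTop 0)).exists
  have hF : ∃ F : Finset (Fin p × Finset (Fin n)),
      ∀ φ ∈ T₀, RealizeS k (Fin n) (structOf k n (configOf F)) φ := by
    by_contra! hF
    refine hn1.not_ge ?_
    simp only [Pn_eq_hprob]
    calc (1 : ℝ) = prob (potentialEdges k n) (edgeProb α γ n) (fun _ => True) := by
          simp [prob, expect_const]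
      _ ≤ _ := prob_le_sum (edgeProb_mem_Icc hα hγ hn) T₀ _ fun F _ _ => hF F
  obtain ⟨F, hF⟩ := hF
  let := structOf k n (configOf F)
  have : Nonempty (Fin n) := ⟨⟨0, hn⟩⟩
  have : Fin n ⊨ (T₀ : (Lang p k).Theory) := ⟨fun φ hφ => hF φ hφ⟩
  exact Language.Theory.Model.isSatisfiable (Fin n)

end ZeroOneLaw

theorem Talpha_consistent_complete (k : Fin p → ℕ) (α γ : Fin p → ℝ)
    (hα : ∀ i, 0 < α i ∧ α i ≤ 1) (hγ : ∀ i, 0 < γ i ∧ γ i ≤ 1)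
    (hirr : IrrHyp α) :
    (Talpha k α γ).IsSatisfiable ∧
      ∀ φ : (Lang p k).Sentence,
        Xor' (φ ∈ Talpha k α γ) (Language.BoundedFormula.not φ ∈ Talpha k α γ) := by
  refine ⟨isSatisfiable_Talpha (fun i => (hα i).1) hγ, fun φ => ?_⟩
  rcases mem_or_not_mem_Talpha (fun i => (hα i).1) hγ hirr φ with h | h
  · exact .inl ⟨h, not_mem_Talpha_of_mem h⟩
  · exact .inr ⟨h, fun h' => not_mem_Talpha_of_mem h' h⟩
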